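/- Let K be a number field. Assume the Riemann hypothesis for ζ_K, and suppose ζ_K has a zero ρ = 1/2 + iγ with γ > 0 of multiplicity m ≥ 1. Then M_K(x) − M̃_K(x) = Ω_±(x^{1/2}(log x)^{m−1}); that is, limsup_{x→∞} (M_K(x) − M̃_K(x))/(x^{1/2}(log x)^{m−1}) > 0 and liminf_{x→∞} (M_K(x) − M̃_K(x))/(x^{1/2}(log x)^{m−1}) < 0, where M̃_K is the correction term corresponding to a possible zero of ζ_K at s = 1/2. -/

import Mathlib

noncomputable section

open NumberField Filter Topology MeasureTheory Complex

open scoped Classical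

/-- The Möbius function on integral ideals of a number field `K`. -/
def moebiusK (K : Type) [Field K] [NumberField K] (I : Ideal (𝓞 K)) : ℤ :=
  if Squarefree I then (-1) ^ (UniqueFactorizationMonoid.factors I).card else 0

/-- The Mertens function of a number field `K`: the sum of `μ_K(𝔞)` over nonzero integral
ideals `𝔞` of norm at most `x`, where ideals of norm exactly `x` count with weight `1/2`. -/
def mertensK (K : Type) [Field K] [NumberField K] (x : ℝ) : ℝ :=
  ∑' I : Ideal (𝓞 K),
    if I ≠ ⊥ ∧ (Ideal.absNorm I : ℝ) < x then (moebiusK K I : ℝ)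
    else if I ≠ ⊥ ∧ (Ideal.absNorm I : ℝ) = x then (moebiusK K I : ℝ) / 2
    else 0

/-- `M_K^- = liminf_{x → ∞} M_K(x) / x^{1/2}`, as an extended real number. -/
def MKminus (K : Type) [Field K] [NumberField K] : EReal :=
  Filter.liminf (fun x : ℝ => ((mertensK K x / Real.sqrt x : ℝ) : EReal)) Filter.atTop

/-- `M_K^+ = limsup_{x → ∞} M_K(x) / x^{1/2}`, as an extended real number. -/
def MKplus (K : Type) [Field K] [NumberField K] : EReal :=
  Filter.limsup (fun x : ℝ => ((mertensK K x / Real.sqrt x : ℝ) : EReal)) Filter.atTop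

/-- The naïve Mertens-type conjecture over `K`: `-1 ≤ M_K^- ≤ M_K^+ ≤ 1`. -/
def NaiveMertensConj (K : Type) [Field K] [NumberField K] : Prop :=
  -1 ≤ MKminus K ∧ MKminus K ≤ MKplus K ∧ MKplus K ≤ 1

/-- A predicate identifying the Dedekind zeta function of `K`: a function analytic away
from `s = 1` agreeing with the Dirichlet series `∑ N(𝔞)^{-s}` on `Re s > 1`. -/
def IsDedekindZeta (K : Type) [Field K] [NumberField K] (Z : ℂ → ℂ) : Prop :=
  (∀ s : ℂ, s ≠ 1 → DifferentiableAt ℂ Z s) ∧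
  ∀ s : ℂ, 1 < s.re →
    Z s = ∑' I : {I : Ideal (𝓞 K) // I ≠ ⊥}, (Ideal.absNorm I.1 : ℂ) ^ (-s)

/-- The Riemann hypothesis for a zeta function `Z`: all nontrivial zeros lie on `Re s = 1/2`. -/
def ZetaRH (Z : ℂ → ℂ) : Prop :=
  ∀ ρ : ℂ, Z ρ = 0 → 0 < ρ.re → ρ.re < 1 → ρ.re = 1 / 2

open ProbabilityTheory in
/-- If the Taylor series at `σ` of the moment generating function of a nonpositive variable is
summable at distance `t`, then the exponential moment at `σ - t` is finite. -/
theorem sub_mem_integrableExpSet_of_summable {Ω : Type*} [MeasurableSpace Ω] {μ : Measure Ω}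
    {X : Ω → ℝ} (hX : Measurable X) (hX0 : ∀ᵐ ω ∂μ, X ω ≤ 0) {σ t : ℝ} (ht : 0 ≤ t)
    (hFint : ∀ n : ℕ, Integrable (fun ω ↦ X ω ^ n * Real.exp (σ * X ω)) μ)
    (hsum : Summable fun n : ℕ ↦ ((n.factorial : ℝ)⁻¹ * (-t) ^ n) *
      ∫ ω, X ω ^ n * Real.exp (σ * X ω) ∂μ) :
    σ - t ∈ integrableExpSet X μ := by
  have hpos (n : ℕ) : ∀ᵐ ω ∂μ, 0 ≤ ((n.factorial : ℝ)⁻¹ * (-t) ^ n) *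
      (X ω ^ n * Real.exp (σ * X ω)) := by
    filter_upwards [hX0] with ω hω
    have : ((n.factorial : ℝ)⁻¹ * (-t) ^ n) * (X ω ^ n * Real.exp (σ * X ω)) =
        (n.factorial : ℝ)⁻¹ * (t * -X ω) ^ n * Real.exp (σ * X ω) := by
      rw [show t * -X ω = (-t) * X ω by ring, mul_pow]; ring
    rw [this]
    have : 0 ≤ t * -X ω := mul_nonneg ht (by linarith)
    positivity
  refine ⟨by fun_prop, ?_⟩
  rw [hasFiniteIntegral_iff_ofReal (by filter_upwards with ω using (Real.exp_pos _).le)]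
  have key : ∀ᵐ ω ∂μ, ENNReal.ofReal (Real.exp ((σ - t) * X ω)) =
      ∑' n : ℕ, ENNReal.ofReal (((n.factorial : ℝ)⁻¹ * (-t) ^ n) *
        (X ω ^ n * Real.exp (σ * X ω))) := by
    filter_upwards [ae_all_iff.2 hpos] with ω hω
    have hs : HasSum (fun n : ℕ ↦ ((n.factorial : ℝ)⁻¹ * (-t) ^ n) *
        (X ω ^ n * Real.exp (σ * X ω))) (Real.exp ((σ - t) * X ω)) := by
      have := (NormedSpace.expSeries_div_hasSum_exp (-t * X ω)).mul_right (Real.exp (σ * X ω))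
      rw [← Real.exp_eq_exp_ℝ, ← Real.exp_add] at this
      convert! this using 1
      · ext n; rw [mul_pow]; ring
      · ring_nf
    rw [← hs.tsum_eq, ENNReal.ofReal_tsum_of_nonneg hω hs.summable]
  rw [lintegral_congr_ae key, lintegral_tsum (fun n ↦ by fun_prop)]
  have h1 (n : ℕ) : ∫⁻ ω, ENNReal.ofReal (((n.factorial : ℝ)⁻¹ * (-t) ^ n) *
        (X ω ^ n * Real.exp (σ * X ω))) ∂μ = ENNReal.ofReal (((n.factorial : ℝ)⁻¹ * (-t) ^ n) *
      ∫ ω, X ω ^ n * Real.exp (σ * X ω) ∂μ) := by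
    rw [← integral_const_mul, ofReal_integral_eq_lintegral_ofReal ((hFint n).const_mul _) (hpos n)]
  simp_rw [h1]
  exact hsum.tsum_ofReal_lt_top

open ProbabilityTheory in
theorem integrableExpSet_mono {Ω : Type*} [MeasurableSpace Ω] {μ : Measure Ω}
    {X : Ω → ℝ} (hX : Measurable X) (hX0 : ∀ᵐ ω ∂μ, X ω ≤ 0) {σ τ : ℝ}
    (h : σ ∈ integrableExpSet X μ) (hστ : σ ≤ τ) : τ ∈ integrableExpSet X μ := by
  refine Integrable.mono' (integrable_of_mem_integrableExpSet h) (by fun_prop) ?_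
  filter_upwards [hX0] with ω hω
  rw [Real.norm_eq_abs, Real.abs_exp, Real.exp_le_exp]
  nlinarith

open ProbabilityTheory in
theorem mul_complexMGF_eq_of_Ioi_subset {Ω : Type*} [MeasurableSpace Ω] {μ : Measure Ω}
    {X : Ω → ℝ} {a b c : ℝ} (hac : a ≤ c)
    {D N : ℂ → ℂ} (hD : DifferentiableOn ℂ D {s | a < s.re})
    (hN : DifferentiableOn ℂ N {s | a < s.re})
    (h : ∀ s : ℂ, b < s.re → D s * complexMGF X μ s = N s)
    (hc : Set.Ioi c ⊆ integrableExpSet X μ) (s : ℂ) (hs : c < s.re) :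
    D s * complexMGF X μ s = N s := by
  have hopen (x : ℝ) : IsOpen {s : ℂ | x < s.re} := isOpen_lt continuous_const continuous_re
  have hsub : {s : ℂ | c < s.re} ⊆ {s | a < s.re} := fun s hs ↦ hac.trans_lt hs
  have h1 : AnalyticOnNhd ℂ (fun s ↦ D s * complexMGF X μ s) {s | c < s.re} := by
    refine DifferentiableOn.analyticOnNhd ?_ (hopen c)
    refine (hD.mono hsub).mul (differentiableOn_complexMGF.mono fun s hs ↦ ?_)
    exact interior_maximal hc isOpen_Ioi hs
  have h2 : AnalyticOnNhd ℂ N {s | c < s.re} :=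
    (hN.mono hsub).analyticOnNhd (hopen c)
  have h3 : ((max b c + 1 : ℝ) : ℂ) ∈ {s : ℂ | c < s.re} := by
    simp only [Set.mem_ofPred_eq, ofReal_re]
    linarith [le_max_right b c]
  refine h1.eqOn_of_preconnected_of_eventuallyEq h2 (convex_halfSpace_re_gt c).isPreconnected h3
    ?_ hs
  filter_upwards [(hopen b).mem_nhds (show ((max b c + 1 : ℝ) : ℂ) ∈ {s : ℂ | b < s.re} by
    simp only [Set.mem_ofPred_eq, ofReal_re]; linarith [le_max_left b c])] with z hz using h z hz

open ProbabilityTheory in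
/-- **Landau's lemma** for Laplace transforms of positive measures: the transform converges as far
to the left as it extends analytically along the real axis. -/
theorem landau_Ioi_subset_integrableExpSet {Ω : Type*} [MeasurableSpace Ω] {μ : Measure Ω}
    {X : Ω → ℝ} (hX : Measurable X) (hX0 : ∀ᵐ ω ∂μ, X ω ≤ 0) {a b : ℝ}
    (hb : Set.Ioi b ⊆ integrableExpSet X μ)
    {D N : ℂ → ℂ} (hD : DifferentiableOn ℂ D {s | a < s.re})
    (hN : DifferentiableOn ℂ N {s | a < s.re})
    (h : ∀ s : ℂ, b < s.re → D s * complexMGF X μ s = N s)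
    (hD0 : ∀ σ : ℝ, a < σ → D σ ≠ 0) :
    Set.Ioi a ⊆ integrableExpSet X μ := by
  intro σ (hσ : a < σ)
  by_contra hσS
  set S := integrableExpSet X μ with hS
  have hlow (τ : ℝ) (hτ : τ ∈ S) : σ < τ := by
    by_contra! hle
    exact hσS (integrableExpSet_mono hX hX0 hτ hle)
  have hne : S.Nonempty := ⟨b + 1, hb (by simp)⟩
  have hbdd : BddBelow S := ⟨σ, fun τ hτ ↦ (hlow τ hτ).le⟩
  set c := sInf S with hcdef
  have hσc : σ ≤ c := le_csInf hne fun τ hτ ↦ (hlow τ hτ).le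
  have hac : a < c := hσ.trans_le hσc
  have hcS : Set.Ioi c ⊆ S := by
    intro τ hτ
    obtain ⟨υ, hυ, hlt⟩ := exists_lt_of_csInf_lt hne hτ
    exact integrableExpSet_mono hX hX0 hυ hlt.le
  have hopen (x : ℝ) : IsOpen {s : ℂ | x < s.re} := isOpen_lt continuous_const continuous_re
  have hid := mul_complexMGF_eq_of_Ioi_subset hac.le hD hN h hcS
  have hcmem : {s : ℂ | a < s.re} ∈ 𝓝 (c : ℂ) := (hopen a).mem_nhds (by simpa using hac)
  have hnz : ∀ᶠ z in 𝓝 (c : ℂ), D z ≠ 0 ∧ a < z.re :=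
    ((hD.continuousOn.continuousAt hcmem).eventually_ne (hD0 c hac)).and hcmem
  obtain ⟨R, hR, hball⟩ := Metric.eventually_nhds_iff_ball.1 hnz
  set σ₁ : ℝ := c + R / 4 with hσ₁
  have hsub : Metric.ball (σ₁ : ℂ) (R / 2) ⊆ Metric.ball (c : ℂ) R := by
    refine Metric.ball_subset_ball' ?_
    rw [hσ₁, dist_eq_norm]
    push_cast
    rw [add_sub_cancel_left]
    norm_num
    rw [abs_of_pos hR]; linarith
  have hf : DifferentiableOn ℂ (fun z ↦ N z / D z) (Metric.ball (σ₁ : ℂ) (R / 2)) := by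
    refine DifferentiableOn.div (hN.mono fun z hz ↦ (hball z (hsub hz)).2)
      (hD.mono fun z hz ↦ (hball z (hsub hz)).2) fun z hz ↦ (hball z (hsub hz)).1
  have hσ₁int : σ₁ ∈ interior S := interior_maximal hcS isOpen_Ioi (by simp [hσ₁, hR])
  have hev : (fun z ↦ N z / D z) =ᶠ[𝓝 (σ₁ : ℂ)] complexMGF X μ := by
    have h1 : Metric.ball (σ₁ : ℂ) (R / 2) ∈ 𝓝 (σ₁ : ℂ) := Metric.ball_mem_nhds _ (by linarith)
    have h2 : {s : ℂ | c < s.re} ∈ 𝓝 (σ₁ : ℂ) := (hopen c).mem_nhds (by simp [hσ₁, hR])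
    filter_upwards [h1, h2] with z hz1 hz2
    rw [div_eq_iff (hball z (hsub hz1)).1, mul_comm, hid z hz2]
  have hz : (((σ₁ - 3 * R / 8 : ℝ)) : ℂ) ∈ Metric.ball (σ₁ : ℂ) (R / 2) := by
    rw [Metric.mem_ball, dist_eq_norm]
    push_cast
    rw [sub_sub_cancel_left, norm_neg]
    norm_num
    rw [abs_of_pos hR]; linarith
  have htay := Complex.hasSum_taylorSeries_on_ball hf hz
  have hder (n : ℕ) : iteratedDeriv n (fun z ↦ N z / D z) (σ₁ : ℂ) =
      ((∫ ω, X ω ^ n * Real.exp (σ₁ * X ω) ∂μ : ℝ) : ℂ) := by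
    rw [(hev.iteratedDeriv_eq n), iteratedDeriv_complexMGF (by simpa using hσ₁int),
      ← integral_complex_ofReal]
    simp
  simp_rw [hder] at htay
  have hsum : Summable fun n : ℕ ↦ ((n.factorial : ℝ)⁻¹ * (-(3 * R / 8)) ^ n) *
      ∫ ω, X ω ^ n * Real.exp (σ₁ * X ω) ∂μ := by
    have := htay.summable
    rw [← Complex.summable_ofReal]
    convert! this using 2 with n
    push_cast
    simp [smul_eq_mul, mul_assoc]
  have := sub_mem_integrableExpSet_of_summable hX hX0 (by positivity)
    (fun n ↦ integrable_pow_mul_exp_of_mem_interior_integrableExpSet hσ₁int n) hsum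
  have := csInf_le hbdd this
  rw [← hcdef] at this
  linarith

section Moebius

variable (K : Type) [Field K] [NumberField K]

theorem abs_moebiusK_le (I : Ideal (𝓞 K)) : |(moebiusK K I : ℝ)| ≤ 1 := by
  unfold moebiusK
  split_ifs <;> simp

theorem moebiusK_top : moebiusK K (1 : Ideal (𝓞 K)) = 1 := by
  rw [moebiusK, if_pos squarefree_one, UniqueFactorizationMonoid.factors_eq_normalizedFactors,
    UniqueFactorizationMonoid.normalizedFactors_one]
  simp

theorem moebiusK_prime_mul {P J : Ideal (𝓞 K)} (hP : Prime P) (hJ : Squarefree J)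
    (hPJ : ¬ P ∣ J) : moebiusK K (P * J) = - moebiusK K J := by
  have hJ0 : J ≠ 0 := hJ.ne_zero
  have hsq : Squarefree (P * J) := by
    rw [squarefree_mul_iff]
    exact ⟨(hP.irreducible.isRelPrime_iff_not_dvd).2 hPJ, hP.irreducible.squarefree, hJ⟩
  have hcard : (UniqueFactorizationMonoid.factors (P * J)).card =
      1 + (UniqueFactorizationMonoid.factors J).card := by
    rw [Multiset.card_eq_card_of_rel (UniqueFactorizationMonoid.factors_mul hP.ne_zero hJ0),
      Multiset.card_add]
    congr 1
    rw [UniqueFactorizationMonoid.factors_eq_normalizedFactors,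
      UniqueFactorizationMonoid.normalizedFactors_irreducible hP.irreducible,
      Multiset.card_singleton]
  rw [moebiusK, moebiusK, if_pos hsq, if_pos hJ, hcard, pow_add]
  simp

theorem sum_moebiusK_squarefree_dvd {L : Ideal (𝓞 K)} (hL : L ≠ 1)
    (s : Finset (Ideal (𝓞 K))) (hs : ∀ J, J ∈ s ↔ Squarefree J ∧ J ∣ L) :
    ∑ J ∈ s, moebiusK K J = 0 := by
  obtain ⟨P, hPm, hLP⟩ := Ideal.exists_le_maximal L (by rwa [← Ideal.one_eq_top])
  by_cases hP0 : P = ⊥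
  · have hLP' : L = ⊥ := by rw [hP0] at hLP; exact le_bot_iff.1 hLP
    exact absurd (hP0 ▸ hPm) (Ring.ne_bot_of_isMaximal_of_not_isField · (RingOfIntegers.not_isField K) rfl)
  have hP : Prime P := Ideal.prime_of_isPrime hP0 hPm.isPrime
  have hPL : P ∣ L := Ideal.dvd_iff_le.2 hLP
  rw [← Finset.sum_filter_add_sum_filter_not s (fun J ↦ P ∣ J), add_comm, ← eq_neg_iff_add_eq_zero,
    ← Finset.sum_neg_distrib]
  trans ∑ J ∈ s with ¬ P ∣ J, -moebiusK K (P * J)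
  · refine Finset.sum_congr rfl fun J hJ ↦ ?_
    rw [Finset.mem_filter, hs] at hJ
    rw [moebiusK_prime_mul K hP hJ.1.1 hJ.2, neg_neg]
  · refine Finset.sum_nbij (fun J ↦ P * J) ?_ ?_ ?_ (fun _ _ ↦ rfl)
    · intro J hJ
      rw [Finset.mem_filter, hs] at hJ ⊢
      have hcop : IsRelPrime P J := (hP.irreducible.isRelPrime_iff_not_dvd).2 hJ.2
      refine ⟨⟨squarefree_mul_iff.2 ⟨hcop, hP.irreducible.squarefree, hJ.1.1⟩, ?_⟩,
        dvd_mul_right _ _⟩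
      exact hcop.mul_dvd hPL hJ.1.2
    · exact fun J _ J' _ h ↦ mul_left_cancel₀ hP0 h
    · intro J hJ
      simp only [Finset.coe_filter, hs, Set.mem_ofPred_eq] at hJ
      obtain ⟨⟨hsq, hJL⟩, J', rfl⟩ := hJ
      refine ⟨J', ?_, rfl⟩
      simp only [Finset.coe_filter, hs, Set.mem_ofPred_eq]
      exact ⟨⟨hsq.of_mul_right, (dvd_mul_left _ _).trans hJL⟩,
        (hP.irreducible.isRelPrime_iff_not_dvd).1 (squarefree_mul_iff.1 hsq).1⟩

/-- Möbius inversion over divisors, indexed by factorizations. -/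
theorem tsum_moebiusK_fiber (L : {I : Ideal (𝓞 K) // I ≠ ⊥}) :
    ∑' p : {p : {I : Ideal (𝓞 K) // I ≠ ⊥} × {I : Ideal (𝓞 K) // I ≠ ⊥} // p.1.1 * p.2.1 = L.1},
      (moebiusK K p.1.2.1 : ℂ) = if L.1 = 1 then 1 else 0 := by
  have hL : L.1 ≠ 0 := L.2
  let : Fintype {J : Ideal (𝓞 K) // J ∣ L.1} := UniqueFactorizationMonoid.fintypeSubtypeDvd L.1 hL
  let e : {p : {I : Ideal (𝓞 K) // I ≠ ⊥} × {I : Ideal (𝓞 K) // I ≠ ⊥} // p.1.1 * p.2.1 = L.1} ≃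
      {J : Ideal (𝓞 K) // J ∣ L.1} :=
    Equiv.ofBijective (fun p ↦ ⟨p.1.2.1, ⟨p.1.1.1, p.2.symm.trans (mul_comm _ _)⟩⟩) (by
      constructor
      · rintro ⟨⟨⟨a, ha⟩, ⟨b, hb⟩⟩, h⟩ ⟨⟨⟨a', ha'⟩, ⟨b', hb'⟩⟩, h'⟩ heq
        simp only [Subtype.mk.injEq] at heq
        subst heq
        simp only at h h'
        have := mul_right_cancel₀ hb (h.trans h'.symm)
        subst this
        rfl
      · rintro ⟨J, I, hI⟩
        have h0 : J * I ≠ 0 := hI ▸ hL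
        exact ⟨⟨⟨⟨I, right_ne_zero_of_mul h0⟩, ⟨J, left_ne_zero_of_mul h0⟩⟩,
          by simp only [hI, mul_comm I J]⟩, rfl⟩)
  rw [← e.symm.tsum_eq, tsum_fintype]
  have he (J : {J : Ideal (𝓞 K) // J ∣ L.1}) : (e.symm J).1.2.1 = J.1 :=
    congrArg Subtype.val (e.apply_symm_apply J)
  simp_rw [he]
  split_ifs with h1
  · have : ∀ J : {J : Ideal (𝓞 K) // J ∣ L.1}, J = ⟨1, one_dvd _⟩ := by
      rintro ⟨J, hJ⟩
      rw [h1] at hJ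
      exact Subtype.ext (isUnit_iff_eq_one.1 (isUnit_of_dvd_one hJ))
    rw [Finset.sum_eq_single ⟨1, one_dvd _⟩ (fun J _ hJ ↦ absurd (this J) hJ) (by simp)]
    simp only [moebiusK_top, Int.cast_one]
  · have hfinite : {J : Ideal (𝓞 K) | J ∣ L.1}.Finite :=
      Set.finite_coe_iff.1 (inferInstanceAs (Finite {J : Ideal (𝓞 K) // J ∣ L.1}))
    have hfin : ∑ J ∈ hfinite.toFinset with Squarefree J,
        moebiusK K J = 0 :=
      sum_moebiusK_squarefree_dvd K h1 _ fun J ↦ by simp [and_comm]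
    have h2 : ∑ J : {J : Ideal (𝓞 K) // J ∣ L.1}, moebiusK K J.1 = 0 := by
      rw [← hfin, Finset.sum_filter_of_ne (fun J _ h ↦ ?_)]
      · exact (Finset.sum_subtype _ (fun J ↦ by simp) _).symm
      · by_contra hsq
        exact h (by simp [moebiusK, hsq])
    exact_mod_cast h2

end Moebius

section DirichletSeries

theorem tsum_eq_tsum_tsum_fiber {α β E : Type*} [NormedAddCommGroup E] [CompleteSpace E]
    (f : α → β) {g : α → E} (hg : Summable g) :
    ∑' a, g a = ∑' b, ∑' a : {a // f a = b}, g a.1 := by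
  rw [← (Equiv.sigmaFiberEquiv f).tsum_eq]
  exact Summable.tsum_sigma (f := fun p ↦ g (Equiv.sigmaFiberEquiv f p))
    ((Equiv.sigmaFiberEquiv f).summable_iff.2 hg)

theorem summable_of_summable_fiber {α β : Type*} (f : α → β) {g : α → ℝ} (hg : ∀ a, 0 ≤ g a)
    (hfin : ∀ b, Finite {a // f a = b}) (h : Summable fun b ↦ ∑' a : {a // f a = b}, g a.1) :
    Summable g := by
  rw [← (Equiv.sigmaFiberEquiv f).summable_iff]
  refine (summable_sigma_of_nonneg fun _ ↦ hg _).2 ⟨fun b ↦ ?_, h⟩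
  have := hfin b
  exact Summable.of_finite

variable (K : Type) [Field K] [NumberField K]

theorem LSeriesSummable_card_absNorm {s : ℂ} (hs : 1 < s.re) :
    LSeriesSummable (fun n ↦ (Nat.card {I : Ideal (𝓞 K) // Ideal.absNorm I = n} : ℂ)) s := by
  have hlim : Tendsto (fun n : ℕ ↦ (∑ k ∈ Finset.Icc 1 n,
      (Nat.card {I : Ideal (𝓞 K) // Ideal.absNorm I = k} : ℝ)) / n) atTop
      (𝓝 (dedekindZeta_residue K)) := by
    refine ((Ideal.tendsto_norm_le_div_atTop₀ K).comp tendsto_natCast_atTop_atTop).congr fun n ↦ ?_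
    simp only [Function.comp_apply, Nat.cast_le, ← Nat.cast_sum]
    congr
    rw [← add_left_inj 1, ← Ideal.card_norm_le_eq_card_norm_le_add_one,
      show Finset.Icc 1 n = Finset.Ioc 0 n from Finset.Icc_succ_left_eq_Ioc _ _,
      show 1 = Nat.card {I : Ideal (𝓞 K) // Ideal.absNorm I = 0} by simp [Ideal.absNorm_eq_zero_iff],
      Finset.sum_Ioc_add_eq_sum_Icc (n.zero_le),
      ← Finset.card_preimage_eq_sum_card_image_eq (fun k _ ↦ Ideal.finite_setOfPred_absNorm_eq k)]
    simp [Set.coe_eq_subtype]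
  refine LSeriesSummable_of_sum_norm_bigO_and_nonneg
    (f := fun n ↦ (Nat.card {I : Ideal (𝓞 K) // Ideal.absNorm I = n} : ℝ)) (r := 1) ?_
    (fun _ ↦ Nat.cast_nonneg _) zero_le_one hs |>.congr ?_
  · refine (Asymptotics.isBigO_of_div_tendsto_nhds ?_ _ (hlim.congr fun n ↦ ?_))
    · filter_upwards [eventually_gt_atTop 0] with n hn h
      simp at h; omega
    · simp
  · simp

theorem sum_fiber_absNorm_cpow (s : ℂ) (n : ℕ) :
    ∑' I : {I : {I : Ideal (𝓞 K) // I ≠ ⊥} // Ideal.absNorm I.1 = n},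
      (Ideal.absNorm I.1.1 : ℂ) ^ (-s) =
    LSeries.term (fun n ↦ (Nat.card {I : Ideal (𝓞 K) // Ideal.absNorm I = n} : ℂ)) s n := by
  have h1 (I : {I : {I : Ideal (𝓞 K) // I ≠ ⊥} // Ideal.absNorm I.1 = n}) :
      (Ideal.absNorm I.1.1 : ℂ) ^ (-s) = (n : ℂ) ^ (-s) := by rw [I.2]
  rcases eq_or_ne n 0 with rfl | hn
  · have : IsEmpty {I : {I : Ideal (𝓞 K) // I ≠ ⊥} // Ideal.absNorm I.1 = 0} :=
      ⟨fun I ↦ I.1.2 (Ideal.absNorm_eq_zero_iff.1 I.2)⟩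
    simp
  · rw [tsum_congr h1, tsum_const, LSeries.term_of_ne_zero hn, cpow_neg, nsmul_eq_mul,
      div_eq_mul_inv]
    congr 2
    refine Nat.card_congr ⟨fun I ↦ ⟨I.1.1, I.2⟩, fun I ↦ ⟨⟨I.1, ?_⟩, I.2⟩, fun _ ↦ rfl, fun _ ↦ rfl⟩
    rintro h
    exact hn (by rw [← I.2, h, Ideal.absNorm_bot])

theorem summable_absNorm_cpow {s : ℂ} (hs : 1 < s.re) :
    Summable fun I : {I : Ideal (𝓞 K) // I ≠ ⊥} ↦ (Ideal.absNorm I.1 : ℂ) ^ (-s) := by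
  have hfin (n : ℕ) : Finite {I : {I : Ideal (𝓞 K) // I ≠ ⊥} // Ideal.absNorm I.1 = n} := by
    have : Finite {I : Ideal (𝓞 K) // Ideal.absNorm I = n} :=
      Set.finite_coe_iff.2 (Ideal.finite_setOfPred_absNorm_eq n)
    exact Finite.of_injective (β := {I : Ideal (𝓞 K) // Ideal.absNorm I = n})
      (fun I ↦ ⟨I.1.1, I.2⟩) fun I J h ↦ by
        simpa [Subtype.ext_iff] using h
  rw [← summable_norm_iff]
  have hnorm (I : {I : Ideal (𝓞 K) // I ≠ ⊥}) :
      ‖(Ideal.absNorm I.1 : ℂ) ^ (-s)‖ = ‖(Ideal.absNorm I.1 : ℂ) ^ (-(s.re : ℂ))‖ := by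
    have : 0 < Ideal.absNorm I.1 := Nat.pos_of_ne_zero fun h ↦ I.2 (Ideal.absNorm_eq_zero_iff.1 h)
    rw [norm_natCast_cpow_of_pos this, norm_natCast_cpow_of_pos this]; simp
  simp_rw [hnorm]
  refine summable_of_summable_fiber (fun I : {I : Ideal (𝓞 K) // I ≠ ⊥} ↦ Ideal.absNorm I.1)
    (fun _ ↦ norm_nonneg _) hfin ?_
  have h2 := (LSeriesSummable_card_absNorm K (s := (s.re : ℂ)) (by simpa using hs)).norm
  refine h2.congr fun n ↦ ?_
  rw [← sum_fiber_absNorm_cpow]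
  have := @Fintype.ofFinite _ (hfin n)
  rw [tsum_fintype, tsum_fintype]
  have hval (I : {I : {I : Ideal (𝓞 K) // I ≠ ⊥} // Ideal.absNorm I.1 = n}) :
      (Ideal.absNorm I.1.1 : ℂ) ^ (-(s.re : ℂ)) = (n : ℂ) ^ (-(s.re : ℂ)) := by rw [I.2]
  simp [hval]

theorem tsum_absNorm_cpow {s : ℂ} (hs : 1 < s.re) :
    ∑' I : {I : Ideal (𝓞 K) // I ≠ ⊥}, (Ideal.absNorm I.1 : ℂ) ^ (-s) = dedekindZeta K s := by
  have h := summable_absNorm_cpow K hs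
  rw [tsum_eq_tsum_tsum_fiber (fun I : {I : Ideal (𝓞 K) // I ≠ ⊥} ↦ Ideal.absNorm I.1) h,
    dedekindZeta, LSeries]
  exact tsum_congr fun n ↦ sum_fiber_absNorm_cpow K s n

theorem summable_moebiusK_cpow {s : ℂ} (hs : 1 < s.re) :
    Summable fun I : {I : Ideal (𝓞 K) // I ≠ ⊥} ↦
      (moebiusK K I.1 : ℂ) * (Ideal.absNorm I.1 : ℂ) ^ (-s) := by
  refine Summable.of_norm_bounded (summable_absNorm_cpow K hs).norm fun I ↦ ?_
  rw [norm_mul]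
  refine mul_le_of_le_one_left (norm_nonneg _) ?_
  have := abs_moebiusK_le K I.1
  rwa [norm_intCast]

theorem tsum_absNorm_cpow_mul_tsum_moebiusK {s : ℂ} (hs : 1 < s.re) :
    (∑' I : {I : Ideal (𝓞 K) // I ≠ ⊥}, (Ideal.absNorm I.1 : ℂ) ^ (-s)) *
      (∑' I : {I : Ideal (𝓞 K) // I ≠ ⊥},
        (moebiusK K I.1 : ℂ) * (Ideal.absNorm I.1 : ℂ) ^ (-s)) = 1 := by
  have h1 := summable_absNorm_cpow K hs
  have h2 := summable_moebiusK_cpow K hs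
  have h3 := summable_mul_of_summable_norm h1.norm h2.norm
  rw [tsum_mul_tsum_of_summable_norm h1.norm h2.norm]
  let f : {I : Ideal (𝓞 K) // I ≠ ⊥} × {I : Ideal (𝓞 K) // I ≠ ⊥} → {I : Ideal (𝓞 K) // I ≠ ⊥} :=
    fun p ↦ ⟨p.1.1 * p.2.1, mul_ne_zero p.1.2 p.2.2⟩
  rw [tsum_eq_tsum_tsum_fiber f h3]
  have key (L : {I : Ideal (𝓞 K) // I ≠ ⊥}) :
      ∑' p : {p // f p = L}, ((Ideal.absNorm p.1.1.1 : ℂ) ^ (-s) *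
        ((moebiusK K p.1.2.1 : ℂ) * (Ideal.absNorm p.1.2.1 : ℂ) ^ (-s))) =
      (Ideal.absNorm L.1 : ℂ) ^ (-s) * (if L.1 = 1 then 1 else 0) := by
    rw [← tsum_moebiusK_fiber K L, ← tsum_mul_left,
      ← (Equiv.subtypeEquivRight (p := fun p ↦ f p = L) (q := fun p ↦ p.1.1 * p.2.1 = L.1)
        fun p ↦ by simp [f, Subtype.ext_iff]).tsum_eq]
    refine tsum_congr fun p ↦ ?_
    have hp : p.1.1.1 * p.1.2.1 = L.1 := congrArg Subtype.val p.2
    have hL : (Ideal.absNorm L.1 : ℂ) ^ (-s) =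
        (Ideal.absNorm p.1.1.1 : ℂ) ^ (-s) * (Ideal.absNorm p.1.2.1 : ℂ) ^ (-s) := by
      rw [← hp, map_mul, Nat.cast_mul, natCast_mul_natCast_cpow]
    rw [hL, Equiv.subtypeEquivRight_apply_coe]
    ring
  rw [tsum_congr key, tsum_eq_single ⟨1, one_ne_zero⟩]
  · simp
  · intro L hL
    rw [if_neg fun h ↦ hL (Subtype.ext h), mul_zero]

end DirichletSeries

section LatticeSum

theorem finite_lattice_norm_le {E : Type*} [NormedAddCommGroup E] [NormedSpace ℝ E]
    [FiniteDimensional ℝ E] (Λ : Submodule ℤ E) [DiscreteTopology Λ] (r : ℝ) :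
    {a : Λ | ‖(a : E)‖ ≤ r}.Finite := by
  have : ProperSpace E := FiniteDimensional.proper ℝ E
  have h := Metric.finite_isBounded_inter_isClosed (K := Metric.closedBall (0 : E) r)
    (s := (Λ.toAddSubgroup : Set E)) DiscreteTopology.isDiscrete Metric.isBounded_closedBall
    (AddSubgroup.isClosed_of_discrete (H := Λ.toAddSubgroup))
  refine Set.Finite.of_finite_image (f := ((↑) : Λ → E)) (h.subset ?_)
    Subtype.coe_injective.injOn
  rintro _ ⟨a, ha, rfl⟩
  exact ⟨by simpa using ha, a.2⟩

/-- Sums of a Lipschitz function over a scaled lattice, with a power-saving error term. -/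
theorem exists_abs_lattice_sum_sub_integral_le {E : Type*} [NormedAddCommGroup E]
    [NormedSpace ℝ E] [FiniteDimensional ℝ E] [MeasurableSpace E] [BorelSpace E] (μ : Measure E)
    [μ.IsAddHaarMeasure] (Λ : Submodule ℤ E) [DiscreteTopology Λ] {D : Set E}
    (hD : IsAddFundamentalDomain Λ D μ) (hDb : Bornology.IsBounded D) {F : E → ℝ} {L : NNReal}
    (hL : LipschitzWith L F) (hF : HasCompactSupport F) :
    ∃ C : ℝ, ∀ T : ℝ, 1 ≤ T →
      |μ.real D * ∑' a : Λ, F (T⁻¹ • (a : E)) - T ^ Module.finrank ℝ E * ∫ x, F x ∂μ| ≤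
        C * T ^ Module.finrank ℝ E / T := by
  have : ProperSpace E := FiniteDimensional.proper ℝ E
  have : Countable Λ := TopologicalSpace.separableSpace_iff_countable.1 inferInstance
  have : VAddInvariantMeasure Λ E μ := ⟨fun c s _ ↦ measure_preimage_add μ (c : E) s⟩
  obtain ⟨R₁, hR₁⟩ := hDb.subset_closedBall 0
  obtain ⟨R₂, hR₂⟩ := hF.isCompact.isBounded.subset_closedBall 0
  set R := max (max R₁ R₂) 0 with hR
  have hR0 : 0 ≤ R := le_max_right _ _
  have hDR : ∀ z ∈ D, ‖z‖ ≤ R := fun z hz ↦ by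
    have := hR₁ hz
    rw [mem_closedBall_zero_iff] at this
    exact this.trans ((le_max_left _ _).trans (le_max_left _ _))
  have hFR : ∀ x, F x ≠ 0 → ‖x‖ ≤ R := fun x hx ↦ by
    have := hR₂ (subset_tsupport _ hx)
    rw [mem_closedBall_zero_iff] at this
    exact this.trans ((le_max_right _ _).trans (le_max_left _ _))
  have hDfin : μ D < ⊤ := hDb.measure_lt_top
  refine ⟨L * R * μ.real (Metric.closedBall 0 (2 * R)), fun T hT ↦ ?_⟩
  have hT0 : 0 < T := by linarith
  have hcont : Continuous fun x ↦ F (T⁻¹ • x) := hL.continuous.comp (continuous_const_smul _)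
  have hcs : HasCompactSupport fun x ↦ F (T⁻¹ • x) :=
    hF.comp_smul (inv_ne_zero hT0.ne')
  have hFint : Integrable (fun x ↦ F (T⁻¹ • x)) μ := hcont.integrable_of_hasCompactSupport hcs
  have hFT : ∀ x, F (T⁻¹ • x) ≠ 0 → ‖x‖ ≤ T * R := fun x hx ↦ by
    have := hFR _ hx
    rw [norm_smul, norm_inv, Real.norm_of_nonneg hT0.le, inv_mul_le_iff₀ hT0] at this
    exact this
  set W : E → ℝ := Set.indicator (Metric.closedBall 0 (T * (2 * R))) 1 with hW
  have hWint : Integrable W μ := by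
    refine (integrable_indicator_iff measurableSet_closedBall).2 ?_
    exact integrableOn_const measure_closedBall_lt_top.ne
  have hW1 : ∀ x, ‖x‖ ≤ T * (2 * R) → W x = 1 := fun x hx ↦ by
    rw [hW, Set.indicator_of_mem (by simpa using hx)]; rfl
  have hW0 : ∀ x, 0 ≤ W x := fun x ↦ Set.indicator_nonneg (fun _ _ ↦ zero_le_one) x
  have hsub (a : Λ) (g : E → ℝ) (hg : Integrable g μ) :
      IntegrableOn (fun z ↦ g (a +ᵥ z)) D μ := by
    have : (fun z ↦ g (a +ᵥ z)) = fun z ↦ g ((a : E) + z) := rfl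
    rw [this]
    exact (hg.comp_add_left (a : E)).integrableOn
  have hfinsupp : {a : Λ | ‖(a : E)‖ ≤ T * (2 * R) + R}.Finite := finite_lattice_norm_le Λ _
  have hstep (a : Λ) : |μ.real D * F (T⁻¹ • (a : E)) - ∫ z in D, F (T⁻¹ • (a +ᵥ z : E)) ∂μ| ≤
      L * R / T * ∫ z in D, W (a +ᵥ z) ∂μ := by
    have h1 : μ.real D * F (T⁻¹ • (a : E)) = ∫ z in D, F (T⁻¹ • (a : E)) ∂μ := by
      simp
    have h2 : IntegrableOn (fun _ : E ↦ F (T⁻¹ • (a : E))) D μ := integrableOn_const hDfin.ne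
    rw [h1, ← integral_sub h2 (hsub a _ hFint),
      ← integral_const_mul, ← Real.norm_eq_abs]
    refine norm_integral_le_of_norm_le ((hsub a _ hWint).const_mul _) ?_
    refine (ae_restrict_iff'₀ hD.nullMeasurableSet).2 (Eventually.of_forall fun z hz ↦ ?_)
    change ‖F (T⁻¹ • (a : E)) - F (T⁻¹ • ((a : E) + z))‖ ≤ L * R / T * W ((a : E) + z)
    by_cases h0 : F (T⁻¹ • (a : E)) = 0 ∧ F (T⁻¹ • ((a : E) + z)) = 0
    · rw [h0.1, h0.2, sub_zero, norm_zero]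
      have := hW0 ((a : E) + z)
      positivity
    · have hz' := hDR z hz
      have hRT : R ≤ T * R := le_mul_of_one_le_left hR0 hT
      have hle : ‖(a : E) + z‖ ≤ T * (2 * R) := by
        by_cases h2 : F (T⁻¹ • (a : E)) = 0
        · have := hFT _ (fun h3 ↦ h0 ⟨h2, h3⟩)
          nlinarith
        · have := hFT _ h2
          have := norm_add_le (a : E) z
          nlinarith
      rw [hW1 _ hle, mul_one, ← dist_eq_norm]
      refine (hL.dist_le_mul _ _).trans ?_
      rw [dist_eq_norm, ← smul_sub, norm_smul, norm_inv, Real.norm_of_nonneg hT0.le,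
        sub_add_cancel_left, norm_neg, mul_div_assoc, div_eq_inv_mul]
      gcongr
  have hz1 : ∀ a : Λ, ¬ ‖(a : E)‖ ≤ T * (2 * R) + R → ∀ z ∈ D, W (a +ᵥ z) = 0 := by
    intro a ha z hz
    change W ((a : E) + z) = 0
    refine Set.indicator_of_notMem (fun h ↦ ha ?_) _
    rw [mem_closedBall_zero_iff] at h
    have := norm_sub_le ((a : E) + z) z
    rw [add_sub_cancel_right] at this
    linarith [hDR z hz]
  have hsummW : (Function.support fun a : Λ ↦ ∫ z in D, W (a +ᵥ z) ∂μ).Finite := by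
    refine hfinsupp.subset fun a ha ↦ ?_
    by_contra h
    refine ha ((integral_congr_ae ?_).trans (integral_zero _ _))
    exact (ae_restrict_iff'₀ hD.nullMeasurableSet).2 (Eventually.of_forall (hz1 a h))
  have hWs : Summable fun a : Λ ↦ ∫ z in D, W (a +ᵥ z) ∂μ := summable_of_hasFiniteSupport hsummW
  have hF1 : Summable fun a : Λ ↦ F (T⁻¹ • (a : E)) := by
    refine summable_of_hasFiniteSupport (hfinsupp.subset fun a ha ↦ ?_)
    have := hFT _ ha
    simp only [Set.mem_ofPred_eq]
    nlinarith
  have hdiff : Summable fun a : Λ ↦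
      (μ.real D * F (T⁻¹ • (a : E)) - ∫ z in D, F (T⁻¹ • (a +ᵥ z : E)) ∂μ) :=
    Summable.of_norm_bounded (hWs.mul_left _) hstep
  have hF2 : Summable fun a : Λ ↦ ∫ z in D, F (T⁻¹ • (a +ᵥ z : E)) ∂μ := by
    simpa using (hF1.mul_left (μ.real D)).sub hdiff
  have hscale : ∫ x, F (T⁻¹ • x) ∂μ = T ^ Module.finrank ℝ E * ∫ x, F x ∂μ := by
    rw [Measure.integral_comp_inv_smul, abs_of_nonneg (by positivity), smul_eq_mul]
  have hWval : ∫ x, W x ∂μ = T ^ Module.finrank ℝ E * μ.real (Metric.closedBall 0 (2 * R)) := by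
    rw [hW, integral_indicator_one measurableSet_closedBall, Measure.real,
      Measure.addHaar_closedBall_mul _ _ hT0.le (by positivity), ENNReal.toReal_mul,
      ENNReal.toReal_ofReal (by positivity), Measure.real]
  rw [← hscale, hD.integral_eq_tsum'' _ hFint, ← tsum_mul_left,
    ← (hF1.mul_left _).tsum_sub hF2, ← Real.norm_eq_abs]
  refine (tsum_of_norm_bounded (hWs.mul_left _).hasSum hstep).trans (le_of_eq ?_)
  rw [tsum_mul_left, ← hD.integral_eq_tsum'' _ hWint, hWval]
  ring

end LatticeSum

section UnitAverage

open scoped Convolution in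
/-- Smooth compactly supported functions whose sum over a lattice is constant. -/
theorem exists_contDiff_tsum_lattice_eq_const {E : Type*} [NormedAddCommGroup E]
    [NormedSpace ℝ E] [FiniteDimensional ℝ E] [MeasurableSpace E] [BorelSpace E]
    (Λ : Submodule ℤ E) [DiscreteTopology Λ] [IsZLattice ℝ Λ] :
    ∃ B : E → ℝ, ContDiff ℝ 1 B ∧ HasCompactSupport B ∧ (∀ x, 0 ≤ B x) ∧
      ∃ κ : ℝ, 0 < κ ∧ ∀ y, ∑' l : Λ, B (y + l) = κ := by
  have : ProperSpace E := FiniteDimensional.proper ℝ E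
  have : Countable Λ := TopologicalSpace.separableSpace_iff_countable.1 inferInstance
  have : Module.Finite ℤ Λ := ZLattice.module_finite ℝ Λ
  have : Module.Free ℤ Λ := ZLattice.module_free ℝ Λ
  let μ : Measure E := Measure.addHaar
  have : VAddInvariantMeasure Λ E μ := ⟨fun c s _ ↦ measure_preimage_add μ (c : E) s⟩
  set b := (Module.Free.chooseBasis ℤ Λ).ofZLatticeBasis ℝ Λ with hb
  set D := ZSpan.fundamentalDomain b with hDdef
  have hD : IsAddFundamentalDomain Λ D μ := ZLattice.isAddFundamentalDomain _ μ
  have hDb : Bornology.IsBounded D := ZSpan.fundamentalDomain_isBounded b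
  have hDm : MeasurableSet D := ZSpan.fundamentalDomain_measurableSet b
  let χ : ContDiffBump (0 : E) := ⟨1, 2, by norm_num, by norm_num⟩
  let B : E → ℝ := (D.indicator (1 : E → ℝ)) ⋆[ContinuousLinearMap.lsmul ℝ ℝ, μ] χ
  have hBval (y : E) : B y = ∫ z in D, χ (y - z) ∂μ := by
    rw [← integral_indicator hDm]
    refine integral_congr_ae (Eventually.of_forall fun z ↦ ?_)
    by_cases hz : z ∈ D <;> simp [hz]
  have hDint : Integrable (D.indicator (1 : E → ℝ)) μ :=
    (integrable_indicator_iff hDm).2 (integrableOn_const hDb.measure_lt_top.ne)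
  have hDcs : HasCompactSupport (D.indicator (1 : E → ℝ)) := by
    refine HasCompactSupport.of_support_subset_isCompact hDb.isCompact_closure ?_
    exact (Set.support_indicator_subset).trans subset_closure
  refine ⟨B, ?_, ?_, fun y ↦ ?_, ∫ x, χ x ∂μ, χ.integral_pos, fun y ↦ ?_⟩
  · exact χ.hasCompactSupport.contDiff_convolution_right (n := 1) _ hDint.locallyIntegrable
      χ.contDiff
  · exact HasCompactSupport.convolution _ hDcs χ.hasCompactSupport
  · rw [hBval]
    exact integral_nonneg fun _ ↦ χ.nonneg
  · have hχ : Integrable (fun x ↦ χ (y - x)) μ := by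
      have : Integrable χ μ := χ.continuous.integrable_of_hasCompactSupport χ.hasCompactSupport
      exact this.comp_sub_left y
    rw [← integral_sub_left_eq_self χ μ y, hD.integral_eq_tsum' _ hχ]
    refine tsum_congr fun l ↦ ?_
    rw [hBval]
    refine setIntegral_congr_fun hDm fun z _ ↦ ?_
    change χ (y + l - z) = χ (y - (-(l : E) + z))
    congr 1
    abel

open NumberField.Units NumberField.Units.dirichletUnitTheorem

variable (K : Type) [Field K] [NumberField K]

theorem card_logEmbedding_fiber (l : unitLattice K) :
    Finite {u : (𝓞 K)ˣ // logEmbedding K (Additive.ofMul u) = l} ∧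
    Nat.card {u : (𝓞 K)ˣ // logEmbedding K (Additive.ofMul u) = l} = torsionOrder K := by
  obtain ⟨u₀, hu₀⟩ : ∃ u₀ : (𝓞 K)ˣ, logEmbedding K (Additive.ofMul u₀) = l := by
    obtain ⟨u, _, hu⟩ := l.2
    exact ⟨u.toMul, hu⟩
  let e : torsion K ≃ {u : (𝓞 K)ˣ // logEmbedding K (Additive.ofMul u) = l} :=
    { toFun := fun t ↦ ⟨t * u₀, by
        rw [ofMul_mul, map_add, hu₀, logEmbedding_eq_zero_iff.2 t.2, zero_add]⟩
      invFun := fun u ↦ ⟨u.1 * u₀⁻¹, by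
        rw [← logEmbedding_eq_zero_iff, ofMul_mul, map_add, ofMul_inv, map_neg, u.2, hu₀,
          add_neg_cancel]⟩
      left_inv := fun t ↦ by simp
      right_inv := fun u ↦ by simp }
  exact ⟨Finite.of_equiv _ e, by rw [← Nat.card_congr e, torsionOrder]⟩

theorem exists_contDiff_tsum_units_eq_const :
    ∃ B : logSpace K → ℝ, ContDiff ℝ 1 B ∧ HasCompactSupport B ∧ (∀ x, 0 ≤ B x) ∧
      ∃ κ : ℝ, 0 < κ ∧ ∀ y,
        Summable (fun u : (𝓞 K)ˣ ↦ B (y + logEmbedding K (Additive.ofMul u))) ∧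
        ∑' u : (𝓞 K)ˣ, B (y + logEmbedding K (Additive.ofMul u)) = κ := by
  obtain ⟨B, hB1, hB2, hB3, κ, hκ, hB4⟩ := exists_contDiff_tsum_lattice_eq_const (unitLattice K)
  let f : (𝓞 K)ˣ → unitLattice K := fun u ↦ ⟨logEmbedding K (Additive.ofMul u), _, trivial, rfl⟩
  have hfin (l : unitLattice K) := (card_logEmbedding_fiber K l).1
  have hcard (l : unitLattice K) := (card_logEmbedding_fiber K l).2
  let e (l : unitLattice K) : {u : (𝓞 K)ˣ // f u = l} ≃
      {u : (𝓞 K)ˣ // logEmbedding K (Additive.ofMul u) = l} :=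
    Equiv.subtypeEquivRight fun u ↦ Subtype.ext_iff
  have hfib (y : logSpace K) (l : unitLattice K) : ∑' u : {u // f u = l},
      B (y + logEmbedding K (Additive.ofMul u.1)) = torsionOrder K * B (y + l) := by
    rw [tsum_congr (g := fun _ ↦ B (y + l)), tsum_const, Nat.card_congr (e l), hcard, nsmul_eq_mul]
    intro u
    have hu : logEmbedding K (Additive.ofMul u.1) = l := congrArg Subtype.val u.2
    rw [hu]
  refine ⟨B, hB1, hB2, hB3, torsionOrder K * κ,
    mul_pos (Nat.cast_pos.2 (torsionOrder_pos K)) hκ, fun y ↦ ?_⟩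
  have hsum : Summable fun u : (𝓞 K)ˣ ↦ B (y + logEmbedding K (Additive.ofMul u)) := by
    refine summable_of_summable_fiber f (fun _ ↦ hB3 _)
      (fun l ↦ (have := hfin l; Finite.of_equiv _ (e l).symm)) ?_
    simp_rw [hfib]
    refine Summable.mul_left _ ?_
    by_contra h
    have := hB4 y
    rw [tsum_eq_zero_of_not_summable h] at this
    exact hκ.ne this
  refine ⟨hsum, ?_⟩
  rw [tsum_eq_tsum_tsum_fiber f hsum]
  simp_rw [hfib]
  rw [tsum_mul_left, hB4]

end UnitAverage

section UnitInvariant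

open NumberField.Units NumberField.Units.dirichletUnitTheorem NumberField.mixedEmbedding
open NumberField.mixedEmbedding.fundamentalCone NumberField.InfinitePlace Module

variable (K : Type) [Field K] [NumberField K]

theorem contDiffAt_normAtPlace {w : InfinitePlace K} {x : mixedSpace K}
    (hx : normAtPlace w x ≠ 0) : ContDiffAt ℝ 1 (normAtPlace w) x := by
  rcases w.isReal_or_isComplex with hw | hw
  · have h : (normAtPlace w : mixedSpace K → ℝ) = fun x ↦ ‖x.1 ⟨w, hw⟩‖ :=
      funext fun x ↦ normAtPlace_apply_of_isReal hw x
    rw [normAtPlace_apply_of_isReal hw, norm_ne_zero_iff] at hx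
    rw [h]
    exact ContDiffAt.norm ℝ (by fun_prop) hx
  · have h : (normAtPlace w : mixedSpace K → ℝ) = fun x ↦ ‖x.2 ⟨w, hw⟩‖ :=
      funext fun x ↦ normAtPlace_apply_of_isComplex hw x
    rw [normAtPlace_apply_of_isComplex hw, norm_ne_zero_iff] at hx
    rw [h]
    exact ContDiffAt.norm ℝ (by fun_prop) hx

/-- The linear coordinates `(log |norm|, logMap)` in terms of the logarithms at all places. -/
def logCoords : (InfinitePlace K → ℝ) →ₗ[ℝ] ℝ × logSpace K :=
  LinearMap.prod (∑ w, (mult w : ℝ) • LinearMap.proj w)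
    (LinearMap.pi fun w ↦ (mult w.1 : ℝ) • (LinearMap.proj w.1 -
      ((finrank ℚ K : ℝ)⁻¹) • (∑ w, (mult w : ℝ) • LinearMap.proj w)))

theorem logCoords_injective : Function.Injective (logCoords K) := by
  rw [← LinearMap.ker_eq_bot, LinearMap.ker_eq_bot']
  intro y hy
  have h1 : ∑ w, (mult w : ℝ) * y w = 0 := by
    simpa [logCoords] using congrArg Prod.fst hy
  have h2 (w : InfinitePlace K) (hw : w ≠ w₀) : y w = 0 := by
    have := congrFun (congrArg Prod.snd hy) ⟨w, hw⟩
    simpa [logCoords, h1, mult_coe_ne_zero] using this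
  funext w
  by_cases hw : w = w₀
  · rw [Finset.sum_eq_single w₀ (fun w _ hw ↦ by rw [h2 w hw, mul_zero]) (by simp)] at h1
    rw [hw]
    exact (mul_eq_zero.1 h1).resolve_left mult_coe_ne_zero
  · exact h2 w hw

theorem logCoords_log_normAtPlace {x : mixedSpace K} (hx : mixedEmbedding.norm x ≠ 0) :
    logCoords K (fun w ↦ Real.log (normAtPlace w x)) =
      (Real.log (mixedEmbedding.norm x), logMap x) := by
  have h : Real.log (mixedEmbedding.norm x) = ∑ w, (mult w : ℝ) * Real.log (normAtPlace w x) := by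
    rw [mixedEmbedding.norm_apply, Real.log_prod]
    · simp
    · exact fun w _ ↦ pow_ne_zero _ (mixedEmbedding.norm_ne_zero_iff.1 hx w)
  refine Prod.ext ?_ ?_
  · simp [logCoords, h]
  · ext w
    simp [logCoords, h, mul_comm]

/-- A Lipschitz compactly supported function on the mixed space whose average over the units is
a prescribed function of the norm. -/
theorem exists_lipschitz_tsum_units_eq {ψ : ℝ → ℝ} (hψ : ContDiff ℝ 1 ψ)
    (hψc : HasCompactSupport ψ) (hψ0 : ∀ t, 0 ≤ ψ t) :
    ∃ Φ : mixedSpace K → ℝ, (∃ L, LipschitzWith L Φ) ∧ HasCompactSupport Φ ∧ (∀ x, 0 ≤ Φ x) ∧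
      Φ 0 = 0 ∧ ∃ κ : ℝ, 0 < κ ∧ ∀ x, mixedEmbedding.norm x ≠ 0 →
        Summable (fun u : (𝓞 K)ˣ ↦ Φ (u • x)) ∧
        ∑' u : (𝓞 K)ˣ, Φ (u • x) = κ * ψ (Real.log (mixedEmbedding.norm x)) := by
  obtain ⟨B, hB1, hB2, hB3, κ, hκ, hB4⟩ := exists_contDiff_tsum_units_eq_const K
  let b : (InfinitePlace K → ℝ) → ℝ := fun y ↦ ψ (logCoords K y).1 * B (logCoords K y).2
  have hb1 : ContDiff ℝ 1 b := by
    have h : ContDiff ℝ 1 (logCoords K) := (LinearMap.toContinuousLinearMap (logCoords K)).contDiff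
    exact (hψ.comp h.fst).mul (hB1.comp h.snd)
  have hb2 : HasCompactSupport b := by
    refine HasCompactSupport.comp_isClosedEmbedding (f := fun p : ℝ × logSpace K ↦ ψ p.1 * B p.2)
      ?_ (LinearMap.isClosedEmbedding_of_injective (logCoords_injective K |> LinearMap.ker_eq_bot.2))
    refine HasCompactSupport.of_support_subset_isCompact (hψc.isCompact.prod hB2.isCompact) ?_
    intro p hp
    exact ⟨subset_tsupport _ (left_ne_zero_of_mul hp), subset_tsupport _ (right_ne_zero_of_mul hp)⟩
  obtain ⟨R, hR⟩ := hb2.isCompact.isBounded.subset_closedBall 0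
  let Φ : mixedSpace K → ℝ := fun x ↦
    if mixedEmbedding.norm x = 0 then 0 else b fun w ↦ Real.log (normAtPlace w x)
  let A : Set (mixedSpace K) :=
    {x | ∀ w, Real.exp (-R) ≤ normAtPlace w x ∧ normAtPlace w x ≤ Real.exp R}
  have hA : IsClosed A := by
    have : A = ⋂ w, {x | Real.exp (-R) ≤ normAtPlace w x} ∩ {x | normAtPlace w x ≤ Real.exp R} := by
      ext; simp [A]
    rw [this]
    exact isClosed_iInter fun w ↦ (isClosed_le continuous_const (continuous_normAtPlace w)).inter
      (isClosed_le (continuous_normAtPlace w) continuous_const)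
  have hAc : IsCompact A := by
    refine Metric.isCompact_of_isClosed_isBounded hA
      ((Metric.isBounded_closedBall (x := (0 : mixedSpace K)) (r := Real.exp R)).subset ?_)
    intro x hx
    rw [mem_closedBall_zero_iff, norm_eq_sup'_normAtPlace]
    exact Finset.sup'_le _ _ fun w _ ↦ (hx w).2
  have hsupp : Function.support Φ ⊆ A := by
    intro x hx w
    have h0 : mixedEmbedding.norm x ≠ 0 := fun h ↦ hx (by simp [Φ, h])
    have hb : b (fun w ↦ Real.log (normAtPlace w x)) ≠ 0 := by
      simpa [Φ, h0] using hx
    have := hR (subset_tsupport _ hb)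
    rw [mem_closedBall_zero_iff] at this
    have h2 := abs_le.1 ((norm_le_pi_norm _ w).trans this)
    have hpos : 0 < normAtPlace w x :=
      (normAtPlace_nonneg w x).lt_of_ne' (mixedEmbedding.norm_ne_zero_iff.1 h0 w)
    exact ⟨(Real.le_log_iff_exp_le hpos).1 h2.1, (Real.log_le_iff_le_exp hpos).1 h2.2⟩
  have hΦc : HasCompactSupport Φ := HasCompactSupport.of_support_subset_isCompact hAc hsupp
  have hΦ1 : ContDiff ℝ 1 Φ := by
    refine contDiff_iff_contDiffAt.2 fun x ↦ ?_
    by_cases hx : x ∈ tsupport Φ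
    swap
    · exact contDiffAt_const.congr_of_eventuallyEq (notMem_tsupport_iff_eventuallyEq.1 hx)
    have hxA : x ∈ A := closure_minimal hsupp hA hx
    have hx0 (w) : normAtPlace w x ≠ 0 := ((Real.exp_pos _).trans_le (hxA w).1).ne'
    have hev : Φ =ᶠ[𝓝 x] fun x ↦ b fun w ↦ Real.log (normAtPlace w x) := by
      have hopen : ∀ᶠ y in 𝓝 x, ∀ w, normAtPlace w y ≠ 0 :=
        eventually_all.2 fun w ↦ (continuous_normAtPlace w).continuousAt.eventually_ne (hx0 w)
      filter_upwards [hopen] with y hy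
      simp [Φ, mixedEmbedding.norm_ne_zero_iff.2 hy]
    refine ContDiffAt.congr_of_eventuallyEq ?_ hev
    refine hb1.contDiffAt.comp x (contDiffAt_pi.2 fun w ↦ ?_)
    exact (contDiffAt_normAtPlace K (hx0 w)).log (hx0 w)
  have hval {x : mixedSpace K} (hx : mixedEmbedding.norm x ≠ 0) :
      Φ x = ψ (Real.log (mixedEmbedding.norm x)) * B (logMap x) := by
    simp only [Φ, if_neg hx, b, logCoords_log_normAtPlace K hx]
  refine ⟨Φ, ContDiff.lipschitzWith_of_hasCompactSupport hΦc hΦ1 one_ne_zero, hΦc, fun x ↦ ?_,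
    by simp [Φ], κ, hκ, fun x hx ↦ ?_⟩
  · by_cases hx : mixedEmbedding.norm x = 0
    · simp [Φ, hx]
    · rw [hval hx]
      exact mul_nonneg (hψ0 _) (hB3 _)
  · have h (u : (𝓞 K)ˣ) : Φ (u • x) = ψ (Real.log (mixedEmbedding.norm x)) *
        B (logMap x + logEmbedding K (Additive.ofMul u)) := by
      rw [hval (by rwa [norm_unit_smul]), norm_unit_smul, logMap_unit_smul _ hx, add_comm]
    simp_rw [h]
    obtain ⟨h1, h2⟩ := hB4 (logMap x)
    exact ⟨h1.mul_left _, by rw [tsum_mul_left, h2, mul_comm]⟩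

end UnitInvariant

section IdealCount

open NumberField.Units NumberField.mixedEmbedding NumberField.InfinitePlace Module
open NumberField.mixedEmbedding.fundamentalCone
open scoped nonZeroDivisors

variable (K : Type) [Field K] [NumberField K]

theorem mk0_eq_inv_iff (J : (Ideal (𝓞 K))⁰) {I : (Ideal (𝓞 K))⁰} :
    ClassGroup.mk0 I = (ClassGroup.mk0 J)⁻¹ ↔ (I.1 * J.1).IsPrincipal := by
  rw [eq_inv_iff_mul_eq_one, ← map_mul, ← Submonoid.coe_mul, ← ClassGroup.mk0_eq_one_iff (I * J).2]

/-- A sum over the lattice of an ideal `J` of a function whose unit averages depend only on the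
norm, as a sum over the integral ideals in the inverse class of `J`. -/
theorem tsum_idealLattice_eq (J : (Ideal (𝓞 K))⁰) {F : mixedSpace K → ℝ} {G : ℝ → ℝ}
    (hF0 : F 0 = 0)
    (hs : Summable fun a : idealLattice K (FractionalIdeal.mk0 K J) ↦ F a)
    (hFG : ∀ x : 𝓞 K, x ≠ 0 → ∑' u : (𝓞 K)ˣ, F (u • mixedEmbedding K x) =
      G (Ideal.absNorm (Ideal.span {x}))) :
    ∑' a : idealLattice K (FractionalIdeal.mk0 K J), F a =
      ∑' I : {I : (Ideal (𝓞 K))⁰ // ClassGroup.mk0 I = (ClassGroup.mk0 J)⁻¹},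
        G (Ideal.absNorm I.1.1 * Ideal.absNorm J.1 : ℕ) := by
  let S := {x : 𝓞 K // x ∈ J.1 ∧ x ≠ 0}
  let j : S → idealLattice K (FractionalIdeal.mk0 K J) := fun x ↦
    ⟨mixedEmbedding K x.1, (mem_idealLattice K _).2 ⟨x.1, by simpa using x.2.1, rfl⟩⟩
  have hj : Function.Injective j := by
    intro x y h
    have := mixedEmbedding_injective K (congrArg Subtype.val h)
    exact Subtype.ext (RingOfIntegers.ext this)
  have hr : Function.support (fun a : idealLattice K (FractionalIdeal.mk0 K J) ↦ F a) ⊆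
      Set.range j := by
    rintro ⟨a, ha⟩ h
    obtain ⟨y, hy, rfl⟩ := (mem_idealLattice K _).1 ha
    have hy' : y ∈ (J.1 : FractionalIdeal (𝓞 K)⁰ K) := by simpa using hy
    obtain ⟨x, hx, rfl⟩ := (FractionalIdeal.mem_coeIdeal _).1 hy'
    refine ⟨⟨x, hx, ?_⟩, rfl⟩
    rintro rfl
    exact h (by simpa using hF0)
  rw [← hj.tsum_eq hr]
  have hex (x : S) : ∃ I : {I : (Ideal (𝓞 K))⁰ // ClassGroup.mk0 I = (ClassGroup.mk0 J)⁻¹},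
      Ideal.span {x.1} = I.1.1 * J.1 := by
    have hdvd : J.1 ∣ Ideal.span {x.1} := Ideal.dvd_span_singleton.2 x.2.1
    obtain ⟨I, hI⟩ := hdvd
    have hI0 : I ∈ (Ideal (𝓞 K))⁰ := by
      refine mem_nonZeroDivisors_of_ne_zero fun h ↦ x.2.2 ?_
      rw [h, mul_zero] at hI
      exact Ideal.span_singleton_eq_bot.1 hI
    have hp : (I * J.1).IsPrincipal := ⟨x.1, by rw [mul_comm, ← hI, Ideal.submodule_span_eq]⟩
    exact ⟨⟨⟨I, hI0⟩, (mk0_eq_inv_iff K J).2 hp⟩, by rw [hI, mul_comm]⟩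
  choose f hf using hex
  rw [tsum_eq_tsum_tsum_fiber f (g := fun x : S ↦ F (j x)) (hs.comp_injective hj)]
  refine tsum_congr fun I ↦ ?_
  have hp : (I.1.1 * J.1).IsPrincipal := (mk0_eq_inv_iff K J).1 I.2
  obtain ⟨x₀, hx₀⟩ := hp
  replace hx₀ : I.1.1 * J.1 = Ideal.span {x₀} := hx₀
  have hx₀0 : x₀ ≠ 0 := by
    rintro rfl
    have h1 : I.1.1 * J.1 = 0 := by simpa using hx₀
    exact (mul_ne_zero (nonZeroDivisors.ne_zero I.1.2) (nonZeroDivisors.ne_zero J.2)) h1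
  have hmem (u : (𝓞 K)ˣ) : (u * x₀ : 𝓞 K) ∈ J.1 := by
    refine Ideal.mul_mem_left _ _ ?_
    have h : x₀ ∈ Ideal.span {x₀} := Ideal.mem_span_singleton_self x₀
    rw [← hx₀] at h
    exact (show I.1.1 * J.1 ≤ J.1 from Ideal.mul_le_right) h
  have hfib (u : (𝓞 K)ˣ) : f ⟨u * x₀, hmem u, mul_ne_zero u.ne_zero hx₀0⟩ = I := by
    have h := hf ⟨u * x₀, hmem u, mul_ne_zero u.ne_zero hx₀0⟩
    simp only [Ideal.span_singleton_mul_left_unit u.isUnit] at h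
    rw [← hx₀] at h
    exact Subtype.ext (Subtype.ext (mul_right_cancel₀ (nonZeroDivisors.ne_zero J.2) h).symm)
  let e : (𝓞 K)ˣ ≃ {x : S // f x = I} := Equiv.ofBijective
    (fun u ↦ ⟨⟨u * x₀, hmem u, mul_ne_zero u.ne_zero hx₀0⟩, hfib u⟩) <| by
      constructor
      · intro u v h
        have h1 : (u * x₀ : 𝓞 K) = v * x₀ := congrArg (fun t ↦ t.1.1) h
        exact Units.ext (mul_right_cancel₀ hx₀0 h1)
      · rintro ⟨x, hx⟩
        have h := hf x
        rw [hx, hx₀, Ideal.span_singleton_eq_span_singleton] at h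
        obtain ⟨u, hu⟩ := h.symm
        exact ⟨u, Subtype.ext (Subtype.ext (by rw [← hu, mul_comm]))⟩
  rw [← e.tsum_eq, ← map_mul, hx₀, ← hFG x₀ hx₀0]
  refine tsum_congr fun u ↦ congrArg F ?_
  exact (unit_smul_eq_iff_mul_eq.2 (by rfl)).symm

end IdealCount

section IdealCount

open NumberField.Units NumberField.mixedEmbedding NumberField.InfinitePlace Module
open NumberField.mixedEmbedding.fundamentalCone
open scoped nonZeroDivisors

variable (K : Type) [Field K] [NumberField K]

/-- Smoothed count of the integral ideals in a class, with a power-saving error term. -/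
theorem exists_abs_tsum_class_sub_le {ψ : ℝ → ℝ} (hψ : ContDiff ℝ 1 ψ)
    (hψc : HasCompactSupport ψ) (hψ0 : ∀ t, 0 ≤ ψ t) (J : (Ideal (𝓞 K))⁰) :
    ∃ c C : ℝ, ∀ T : ℝ, 1 ≤ T →
      |∑' I : {I : (Ideal (𝓞 K))⁰ // ClassGroup.mk0 I = (ClassGroup.mk0 J)⁻¹},
        ψ (Real.log (T⁻¹ ^ finrank ℚ K * (Ideal.absNorm I.1.1 * Ideal.absNorm J.1 : ℕ))) -
          c * T ^ finrank ℚ K| ≤ C * (T ^ finrank ℚ K / T) := by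
  obtain ⟨Φ, ⟨L, hL⟩, hΦc, hΦ0, hΦz, κ, hκ, hΦ⟩ := exists_lipschitz_tsum_units_eq K hψ hψc hψ0
  set Λ := idealLattice K (FractionalIdeal.mk0 K J)
  set D := ZSpan.fundamentalDomain (fractionalIdealLatticeBasis K (FractionalIdeal.mk0 K J))
  have hDb : Bornology.IsBounded D := ZSpan.fundamentalDomain_isBounded _
  obtain ⟨C, hC⟩ := exists_abs_lattice_sum_sub_integral_le volume Λ
    (fundamentalDomain_idealLattice K _) hDb hL hΦc
  have hvol : 0 < volume.real D :=
    ENNReal.toReal_pos (ZSpan.measure_fundamentalDomain_ne_zero _) hDb.measure_lt_top.ne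
  refine ⟨(∫ x, Φ x) / (volume.real D * κ), C / (volume.real D * κ), fun T hT ↦ ?_⟩
  have hT0 : 0 < T := one_pos.trans_le hT
  have hfin : (Function.support fun a : Λ ↦ Φ (T⁻¹ • (a : mixedSpace K))).Finite := by
    obtain ⟨R, hR⟩ := hΦc.isCompact.isBounded.subset_closedBall 0
    refine (finite_lattice_norm_le Λ (T * R)).subset fun a ha ↦ ?_
    have := hR (subset_tsupport _ ha)
    rwa [mem_closedBall_zero_iff, _root_.norm_smul, norm_inv, Real.norm_of_nonneg hT0.le,
      inv_mul_le_iff₀ hT0] at this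
  have key := tsum_idealLattice_eq K J (F := fun x ↦ Φ (T⁻¹ • x))
    (G := fun t ↦ κ * ψ (Real.log (T⁻¹ ^ finrank ℚ K * t))) (by simpa using hΦz)
    (summable_of_hasFiniteSupport hfin) fun x hx ↦ by
      have hn : mixedEmbedding.norm (T⁻¹ • mixedEmbedding K x) =
          T⁻¹ ^ finrank ℚ K * Ideal.absNorm (Ideal.span {x}) := by
        rw [mixedEmbedding.norm_smul, abs_of_pos (inv_pos.2 hT0), mixedEmbedding.norm_eq_norm,
          Ideal.absNorm_span_singleton, ← Algebra.coe_norm_int]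
        simp [Nat.cast_natAbs]
      have h0 : mixedEmbedding.norm (T⁻¹ • mixedEmbedding K x) ≠ 0 := by
        rw [hn]
        refine mul_ne_zero (by positivity) (Nat.cast_ne_zero.2 ?_)
        rw [Ne, Ideal.absNorm_eq_zero_iff, Ideal.span_singleton_eq_bot]
        exact hx
      rw [← hn, ← (hΦ _ h0).2]
      refine tsum_congr fun u ↦ congrArg Φ ?_
      rw [unitSMul_smul, unitSMul_smul, mul_smul_comm]
  have h := hC T hT
  rw [key, tsum_mul_left, mixedEmbedding.finrank] at h
  have hpos : 0 < volume.real D * κ := mul_pos hvol hκ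
  have heq (S : ℝ) : volume.real D * (κ * S) - T ^ finrank ℚ K * ∫ x, Φ x =
      (S - (∫ x, Φ x) / (volume.real D * κ) * T ^ finrank ℚ K) * (volume.real D * κ) := by
    field_simp
  rw [heq, abs_mul, abs_of_pos hpos, ← le_div_iff₀ hpos] at h
  exact h.trans_eq (by ring)

theorem hasFiniteSupport_ideal {ψ : ℝ → ℝ} (hψc : HasCompactSupport ψ) (u : ℝ) :
    (Function.support fun I : {I : Ideal (𝓞 K) // I ≠ ⊥} ↦
      ψ (Real.log (Ideal.absNorm I.1) - u)).Finite := by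
  obtain ⟨R, hR⟩ := hψc.isCompact.isBounded.subset_closedBall 0
  refine Set.Finite.of_finite_image (f := Subtype.val)
    ((Ideal.finite_setOfPred_absNorm_le ⌊Real.exp (R + u)⌋₊).subset ?_) Subtype.coe_injective.injOn
  rintro _ ⟨I, hI, rfl⟩
  have h := hR (subset_tsupport _ hI)
  rw [mem_closedBall_zero_iff] at h
  have h0 : (0 : ℝ) < Ideal.absNorm I.1 := by
    exact_mod_cast Nat.pos_of_ne_zero (Ideal.absNorm_eq_zero_iff.not.2 I.2)
  refine Nat.le_floor ((Real.log_le_iff_le_exp h0).1 ?_)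
  linarith [(abs_le.1 h).2]

/-- Smoothed count of the integral ideals, with a power-saving error term. -/
theorem exists_abs_tsum_ideal_sub_le {ψ : ℝ → ℝ} (hψ : ContDiff ℝ 1 ψ)
    (hψc : HasCompactSupport ψ) (hψ0 : ∀ t, 0 ≤ ψ t) :
    ∃ c C : ℝ, ∀ u : ℝ, 0 ≤ u →
      |∑' I : {I : Ideal (𝓞 K) // I ≠ ⊥}, ψ (Real.log (Ideal.absNorm I.1) - u) -
        c * Real.exp u| ≤ C * Real.exp ((1 - (finrank ℚ K : ℝ)⁻¹) * u) := by
  have hn : (0 : ℝ) < finrank ℚ K := by exact_mod_cast finrank_pos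
  choose J hJ using fun C : ClassGroup (𝓞 K) ↦ ClassGroup.mk0_surjective (C⁻¹)
  choose c C hC using fun D : ClassGroup (𝓞 K) ↦ exists_abs_tsum_class_sub_le K hψ hψc hψ0 (J D)
  have hpos (I : (Ideal (𝓞 K))⁰) : (0 : ℝ) < Ideal.absNorm I.1 :=
    Nat.cast_pos.2 (Ideal.absNorm_pos_of_nonZeroDivisors I)
  refine ⟨∑ D, c D * Ideal.absNorm (J D).1, ∑ D, |C D| * Ideal.absNorm (J D).1, fun u hu ↦ ?_⟩
  let e : (Ideal (𝓞 K))⁰ ≃ {I : Ideal (𝓞 K) // I ≠ ⊥} :=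
    Equiv.subtypeEquivRight fun I ↦ mem_nonZeroDivisors_iff_ne_zero
  have hs : Summable fun I : (Ideal (𝓞 K))⁰ ↦ ψ (Real.log (Ideal.absNorm I.1) - u) :=
    e.summable_iff.2 (summable_of_hasFiniteSupport (hasFiniteSupport_ideal K hψc u))
  have hsum : ∑' I : {I : Ideal (𝓞 K) // I ≠ ⊥}, ψ (Real.log (Ideal.absNorm I.1) - u) =
      ∑ D : ClassGroup (𝓞 K), ∑' I : {I : (Ideal (𝓞 K))⁰ // ClassGroup.mk0 I = D},
        ψ (Real.log (Ideal.absNorm I.1.1) - u) := by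
    rw [← e.tsum_eq, ← tsum_fintype (L := .unconditional _)]
    exact tsum_eq_tsum_tsum_fiber _ hs
  rw [hsum, Finset.sum_mul, Finset.sum_mul, ← Finset.sum_sub_distrib]
  refine (Finset.abs_sum_le_sum_abs _ _).trans (Finset.sum_le_sum fun D _ ↦ ?_)
  set N : ℝ := (Ideal.absNorm (J D).1 : ℝ) with hN
  have hN0 : 0 < N := hpos _
  have hN1 : 1 ≤ N := Nat.one_le_cast.2 <| Ideal.absNorm_pos_of_nonZeroDivisors (J D)
  set T := Real.exp ((u + Real.log N) / finrank ℚ K) with hTdef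
  have hT1 : 1 ≤ T := Real.one_le_exp (div_nonneg (add_nonneg hu (Real.log_nonneg hN1)) hn.le)
  have hTn : T ^ finrank ℚ K = N * Real.exp u := by
    rw [hTdef, ← Real.exp_nat_mul, mul_div_cancel₀ _ hn.ne', Real.exp_add, Real.exp_log hN0,
      mul_comm]
  have h := hC D T hT1
  rw [hJ, inv_inv] at h
  have hterm (I : {I : (Ideal (𝓞 K))⁰ // ClassGroup.mk0 I = D}) :
      Real.log (T⁻¹ ^ finrank ℚ K * (Ideal.absNorm I.1.1 * Ideal.absNorm (J D).1 : ℕ)) =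
        Real.log (Ideal.absNorm I.1.1) - u := by
    have : T⁻¹ ^ finrank ℚ K * (Ideal.absNorm I.1.1 * Ideal.absNorm (J D).1 : ℕ) =
        Ideal.absNorm I.1.1 / Real.exp u := by
      rw [inv_pow, hTn, Nat.cast_mul, ← hN]
      field_simp
    rw [this, Real.log_div (hpos _).ne' (Real.exp_pos _).ne', Real.log_exp]
  simp only [hterm] at h
  rw [hTn, ← mul_assoc] at h
  refine h.trans ?_
  have hTinv : T⁻¹ ≤ Real.exp (-(finrank ℚ K : ℝ)⁻¹ * u) := by
    rw [hTdef, ← Real.exp_neg]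
    refine Real.exp_le_exp.2 ?_
    rw [neg_mul, neg_le_neg_iff, inv_mul_eq_div]
    gcongr
    linarith [Real.log_nonneg hN1]
  calc C D * (N * Real.exp u / T) ≤ |C D| * (N * Real.exp u * T⁻¹) := by
        rw [div_eq_mul_inv]
        gcongr
        exact le_abs_self _
    _ ≤ |C D| * (N * Real.exp u * Real.exp (-(finrank ℚ K : ℝ)⁻¹ * u)) := by gcongr
    _ = |C D| * N * Real.exp ((1 - (finrank ℚ K : ℝ)⁻¹) * u) := by
        rw [mul_assoc N, ← Real.exp_add, ← mul_assoc]
        ring_nf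

end IdealCount

section Laplace

open ProbabilityTheory

theorem measurable_tsum_of_summable {α ι : Type*} [MeasurableSpace α] [Countable ι]
    {f : ι → α → ℝ} (hf : ∀ i, Measurable (f i)) (hs : ∀ x, Summable fun i ↦ f i x) :
    Measurable fun x ↦ ∑' i, f i x :=
  measurable_of_tendsto_metrizable' atTop
    (f := fun s : Finset ι ↦ fun x ↦ ∑ i ∈ s, f i x)
    (fun s ↦ Finset.measurable_fun_sum s fun i _ ↦ hf i)
    (tendsto_pi_nhds.2 fun x ↦ (hs x).hasSum)

/-- The Laplace transform of a real function on the positive half-line. -/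
def laplaceR (f : ℝ → ℝ) (s : ℂ) : ℂ := ∫ u in Set.Ioi (0 : ℝ), (f u : ℂ) * cexp (-(s * u))

/-- The measure on the positive half-line with density `f`. -/
def laplaceMeasure (f : ℝ → ℝ) : Measure ℝ :=
  (volume.restrict (Set.Ioi 0)).withDensity fun u ↦ ENNReal.ofReal (f u)

/-- Measurable functions on the positive half-line which are `O(exp (a u))`. -/
def ExpBdd (a : ℝ) (f : ℝ → ℝ) : Prop :=
  Measurable f ∧ ∃ C : ℝ, ∀ u, 0 < u → |f u| ≤ C * Real.exp (a * u)

theorem ae_neg_le_zero_laplaceMeasure (f : ℝ → ℝ) : ∀ᵐ u ∂laplaceMeasure f, -u ≤ 0 := by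
  refine (withDensity_absolutelyContinuous _ _).ae_le ?_
  filter_upwards [ae_restrict_mem measurableSet_Ioi] with u hu
  exact (neg_neg_of_pos hu).le

theorem mem_integrableExpSet_laplaceMeasure {f : ℝ → ℝ} (hf : Measurable f)
    (h0 : ∀ u, 0 < u → 0 ≤ f u) {σ : ℝ} :
    σ ∈ integrableExpSet (fun u ↦ -u) (laplaceMeasure f) ↔
      IntegrableOn (fun u ↦ f u * Real.exp (-(σ * u))) (Set.Ioi 0) := by
  rw [integrableExpSet, Set.mem_ofPred_eq, laplaceMeasure,
    integrable_withDensity_iff_integrable_smul' (by fun_prop) (by simp)]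
  refine integrable_congr ?_
  filter_upwards [ae_restrict_mem measurableSet_Ioi] with u hu
  rw [ENNReal.toReal_ofReal (h0 u hu), smul_eq_mul, mul_neg]

theorem complexMGF_laplaceMeasure {f : ℝ → ℝ} (hf : Measurable f)
    (h0 : ∀ u, 0 < u → 0 ≤ f u) (s : ℂ) :
    complexMGF (fun u ↦ -u) (laplaceMeasure f) s = laplaceR f s := by
  rw [complexMGF, laplaceMeasure, laplaceR,
    integral_withDensity_eq_integral_toReal_smul (by fun_prop) (by simp)]
  refine integral_congr_ae ?_
  filter_upwards [ae_restrict_mem measurableSet_Ioi] with u hu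
  rw [ENNReal.toReal_ofReal (h0 u hu), Complex.real_smul]
  push_cast
  rw [mul_neg]

namespace ExpBdd

variable {a b : ℝ} {f g : ℝ → ℝ}

theorem mono (hf : ExpBdd a f) (hab : a ≤ b) : ExpBdd b f := by
  obtain ⟨hm, C, hC⟩ := hf
  refine ⟨hm, |C|, fun u hu ↦ (hC u hu).trans ?_⟩
  gcongr
  exact le_abs_self _

theorem add (hf : ExpBdd a f) (hg : ExpBdd a g) : ExpBdd a fun u ↦ f u + g u := by
  obtain ⟨hm, C, hC⟩ := hf
  obtain ⟨hm', C', hC'⟩ := hg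
  refine ⟨hm.add hm', C + C', fun u hu ↦ (abs_add_le _ _).trans ?_⟩
  rw [add_mul]
  exact add_le_add (hC u hu) (hC' u hu)

theorem const_mul (hf : ExpBdd a f) (r : ℝ) : ExpBdd a fun u ↦ r * f u := by
  obtain ⟨hm, C, hC⟩ := hf
  refine ⟨hm.const_mul r, |r| * C, fun u hu ↦ ?_⟩
  rw [abs_mul, mul_assoc]
  exact mul_le_mul_of_nonneg_left (hC u hu) (abs_nonneg r)

theorem sum {ι : Type*} (s : Finset ι) {f : ι → ℝ → ℝ} (hf : ∀ i ∈ s, ExpBdd a (f i)) :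
    ExpBdd a fun u ↦ ∑ i ∈ s, f i u := by
  induction s using Finset.induction_on with
  | empty => exact ⟨by simp, 0, by simp⟩
  | insert i s hi ih =>
    simp_rw [Finset.sum_insert hi]
    exact (hf i (Finset.mem_insert_self _ _)).add
      (ih fun j hj ↦ hf j (Finset.mem_insert_of_mem hj))

theorem integrableOn (hf : ExpBdd a f) {σ : ℝ} (hσ : a < σ) :
    IntegrableOn (fun u ↦ f u * Real.exp (-(σ * u))) (Set.Ioi 0) := by
  obtain ⟨hm, C, hC⟩ := hf
  refine Integrable.mono' ((integrableOn_exp_mul_Ioi (sub_neg.2 hσ) 0).const_mul C)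
    (by fun_prop) ?_
  filter_upwards [ae_restrict_mem measurableSet_Ioi] with u hu
  rw [norm_mul, Real.norm_eq_abs, Real.norm_eq_abs, Real.abs_exp]
  refine (mul_le_mul_of_nonneg_right (hC u hu) (Real.exp_pos _).le).trans_eq ?_
  rw [mul_assoc, ← Real.exp_add]
  ring_nf

theorem integrableOn_cexp (hf : ExpBdd a f) {s : ℂ} (hs : a < s.re) :
    IntegrableOn (fun u : ℝ ↦ (f u : ℂ) * cexp (-(s * u))) (Set.Ioi 0) := by
  have hm := hf.1
  refine Integrable.mono' (hf.integrableOn hs).norm (by fun_prop) (ae_of_all _ fun u ↦ ?_)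
  simp [Complex.norm_exp]

theorem laplaceR_add (hf : ExpBdd a f) (hg : ExpBdd a g) {s : ℂ} (hs : a < s.re) :
    laplaceR (fun u ↦ f u + g u) s = laplaceR f s + laplaceR g s := by
  rw [laplaceR, laplaceR, laplaceR,
    ← integral_add (hf.integrableOn_cexp hs) (hg.integrableOn_cexp hs)]
  simp only [ofReal_add, add_mul]

end ExpBdd

theorem laplaceR_const_mul (r : ℝ) (f : ℝ → ℝ) (s : ℂ) :
    laplaceR (fun u ↦ r * f u) s = r * laplaceR f s := by
  rw [laplaceR, laplaceR, ← integral_const_mul]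
  simp only [ofReal_mul, mul_assoc]

theorem ExpBdd.laplaceR_sum {a : ℝ} {ι : Type*} (t : Finset ι) {f : ι → ℝ → ℝ}
    (hf : ∀ i ∈ t, ExpBdd a (f i)) {s : ℂ} (hs : a < s.re) :
    laplaceR (fun u ↦ ∑ i ∈ t, f i u) s = ∑ i ∈ t, laplaceR (f i) s := by
  simp only [laplaceR]
  rw [← integral_finsetSum _ fun i hi ↦ (hf i hi).integrableOn_cexp hs]
  simp only [ofReal_sum, Finset.sum_mul]

theorem ExpBdd.differentiableOn_laplaceR {a : ℝ} {f : ℝ → ℝ} (hf : ExpBdd a f) :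
    DifferentiableOn ℂ (laplaceR f) {s | a < s.re} := by
  have key {g : ℝ → ℝ} (hg : ExpBdd a g) (hg0 : ∀ u, 0 ≤ g u) :
      DifferentiableOn ℂ (laplaceR g) {s | a < s.re} := by
    have heq : laplaceR g = complexMGF (fun u ↦ -u) (laplaceMeasure g) :=
      funext fun s ↦ (complexMGF_laplaceMeasure hg.1 (fun u _ ↦ hg0 u) s).symm
    rw [heq]
    refine differentiableOn_complexMGF.mono fun s hs ↦ ?_
    refine interior_mono (s := Set.Ioi a) (fun σ hσ ↦ ?_) (by rwa [interior_Ioi])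
    exact (mem_integrableExpSet_laplaceMeasure hg.1 fun u _ ↦ hg0 u).2 (hg.integrableOn hσ)
  obtain ⟨hm, C, hC⟩ := hf
  have hp : ExpBdd a fun u ↦ max (f u) 0 := ⟨by fun_prop, C, fun u hu ↦ by
    rw [abs_of_nonneg (le_max_right _ _)]
    exact (max_le (le_abs_self _) (abs_nonneg _)).trans (hC u hu)⟩
  have hn : ExpBdd a fun u ↦ max (-f u) 0 := ⟨by fun_prop, C, fun u hu ↦ by
    rw [abs_of_nonneg (le_max_right _ _)]
    exact (max_le (neg_le_abs _) (abs_nonneg _)).trans (hC u hu)⟩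
  refine ((key hp fun u ↦ le_max_right _ _).sub (key hn fun u ↦ le_max_right _ _)).congr
    fun s hs ↦ ?_
  simp only [laplaceR, Pi.sub_apply]
  rw [← integral_sub (hp.integrableOn_cexp hs) (hn.integrableOn_cexp hs)]
  refine integral_congr_ae (ae_of_all _ fun u ↦ ?_)
  dsimp only
  rw [← sub_mul, ← ofReal_sub]
  congr 2
  rcases le_total 0 (f u) with h | h
  · rw [max_eq_left h, max_eq_right (by linarith), sub_zero]
  · rw [max_eq_right h, max_eq_left (by linarith), zero_sub, neg_neg]

theorem eq_of_differentiableOn_of_eq_ofReal {f g : ℂ → ℂ} {a b : ℝ}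
    (hf : DifferentiableOn ℂ f {s | a < s.re}) (hg : DifferentiableOn ℂ g {s | a < s.re})
    (h : ∀ σ : ℝ, b < σ → f σ = g σ) {s : ℂ} (hs : a < s.re) : f s = g s := by
  have hopen : IsOpen {s : ℂ | a < s.re} := isOpen_lt continuous_const continuous_re
  set x := max a b + 1 with hx
  have hxa : a < x := (le_max_left a b).trans_lt (lt_add_one _)
  have hxb : b < x := (le_max_right a b).trans_lt (lt_add_one _)
  refine (hf.analyticOnNhd hopen).eqOn_of_preconnected_of_frequently_eq
    (hg.analyticOnNhd hopen) (convex_halfSpace_re_gt a).isPreconnected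
    (z₀ := (x : ℂ)) (by simpa using hxa) ?_ hs
  have ht : Tendsto (fun t : ℝ ↦ (t : ℂ)) (𝓝[>] x) (𝓝[≠] (x : ℂ)) := by
    refine tendsto_nhdsWithin_iff.2 ⟨(continuous_ofReal.tendsto x).mono_left nhdsWithin_le_nhds, ?_⟩
    filter_upwards [self_mem_nhdsWithin] with t ht
    simpa using (Set.mem_Ioi.1 ht).ne'
  refine ht.frequently (Eventually.frequently ?_)
  filter_upwards [self_mem_nhdsWithin] with t ht
  exact h t (hxb.trans ht)

theorem expBdd_pow_mul_exp (k : ℕ) {b c : ℝ} (hbc : b < c) :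
    ExpBdd c fun u ↦ u ^ k * Real.exp (b * u) := by
  have hd : 0 < c - b := sub_pos.2 hbc
  refine ⟨by fun_prop, k.factorial / (c - b) ^ k, fun u hu ↦ ?_⟩
  rw [abs_of_nonneg (by positivity)]
  have h := Real.pow_div_factorial_le_exp ((c - b) * u) (by positivity) k
  rw [div_le_iff₀ (by positivity), mul_pow] at h
  have : u ^ k ≤ k.factorial / (c - b) ^ k * Real.exp ((c - b) * u) := by
    rw [div_mul_eq_mul_div, le_div_iff₀ (by positivity)]
    linarith
  calc u ^ k * Real.exp (b * u)
      ≤ (k.factorial / (c - b) ^ k * Real.exp ((c - b) * u)) * Real.exp (b * u) := by gcongr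
    _ = _ := by rw [mul_assoc, ← Real.exp_add]; ring_nf

theorem laplaceR_pow_mul_exp (k : ℕ) {b : ℝ} {s : ℂ} (hs : b < s.re) :
    laplaceR (fun u ↦ u ^ k * Real.exp (b * u)) s = k.factorial / (s - b) ^ (k + 1) := by
  obtain ⟨c, hbc, hcs⟩ := exists_between hs
  refine eq_of_differentiableOn_of_eq_ofReal (a := c) (b := c)
    (g := fun s ↦ k.factorial / (s - b) ^ (k + 1))
    (expBdd_pow_mul_exp k hbc).differentiableOn_laplaceR ?_ (fun σ hσ ↦ ?_) hcs
  · refine DifferentiableOn.div (by fun_prop) (by fun_prop) fun z hz ↦ pow_ne_zero _ ?_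
    intro h
    rw [sub_eq_zero] at h
    rw [h, Set.mem_ofPred_eq, ofReal_re] at hz
    exact absurd hz hbc.not_gt
  · have hσb : 0 < σ - b := sub_pos.2 (hbc.trans hσ)
    have h := Real.integral_rpow_mul_exp_neg_mul_Ioi (a := k + 1) (r := σ - b) (by positivity) hσb
    rw [Real.Gamma_nat_eq_factorial] at h
    have h2 : laplaceR (fun u ↦ u ^ k * Real.exp (b * u)) σ =
        ((∫ t in Set.Ioi (0 : ℝ), t ^ ((k : ℝ) + 1 - 1) * Real.exp (-((σ - b) * t)) : ℝ) : ℂ) := by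
      refine Eq.trans (integral_congr_ae (ae_of_all _ fun u ↦ ?_)) (integral_ofReal (𝕜 := ℂ))
      dsimp only [coe_algebraMap]
      rw [add_sub_cancel_right, Real.rpow_natCast]
      push_cast
      rw [mul_assoc, ← Complex.exp_add]
      ring_nf
    rw [h2, h]
    rw [show ((k : ℝ) + 1) = ((k + 1 : ℕ) : ℝ) by push_cast; rfl, Real.rpow_natCast]
    push_cast
    rw [one_div, inv_pow, mul_comm, div_eq_mul_inv]

end Laplace

section MertensLaplace

variable (K : Type) [Field K] [NumberField K]

theorem absNorm_pos_of_ne_bot (I : {I : Ideal (𝓞 K) // I ≠ ⊥}) :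
    (0 : ℝ) < Ideal.absNorm I.1 := by
  exact_mod_cast Nat.pos_of_ne_zero (Ideal.absNorm_eq_zero_iff.not.2 I.2)

theorem one_le_absNorm_of_ne_bot (I : {I : Ideal (𝓞 K) // I ≠ ⊥}) :
    (1 : ℝ) ≤ Ideal.absNorm I.1 := by
  exact_mod_cast Nat.pos_of_ne_zero (Ideal.absNorm_eq_zero_iff.not.2 I.2)

theorem norm_absNorm_cpow (I : {I : Ideal (𝓞 K) // I ≠ ⊥}) (s : ℂ) :
    ‖(Ideal.absNorm I.1 : ℂ) ^ (-s)‖ = Real.exp (-(s.re * Real.log (Ideal.absNorm I.1))) := by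
  rw [← ofReal_natCast, norm_cpow_eq_rpow_re_of_pos (absNorm_pos_of_ne_bot K I),
    Real.rpow_def_of_pos (absNorm_pos_of_ne_bot K I), neg_re]
  ring_nf

theorem absNorm_cpow_eq_cexp (I : {I : Ideal (𝓞 K) // I ≠ ⊥}) (s : ℂ) :
    (Ideal.absNorm I.1 : ℂ) ^ (-s) = cexp (-(s * Real.log (Ideal.absNorm I.1))) := by
  have h := absNorm_pos_of_ne_bot K I
  rw [cpow_def_of_ne_zero (by exact_mod_cast h.ne'), ← natCast_log]
  ring_nf

theorem summable_exp_log_absNorm {σ : ℝ} (hσ : 1 < σ) :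
    Summable fun I : {I : Ideal (𝓞 K) // I ≠ ⊥} ↦
      Real.exp (-(σ * Real.log (Ideal.absNorm I.1))) := by
  have h := (summable_absNorm_cpow K (s := σ) (by simpa using hσ)).norm
  simpa [norm_absNorm_cpow] using h

instance countable_ne_bot : Countable {I : Ideal (𝓞 K) // I ≠ ⊥} := by
  have h := (summable_exp_log_absNorm K (σ := 2) (by norm_num)).countable_support
  rw [Function.support_eq_univ fun I ↦ (Real.exp_pos _).ne'] at h
  exact Set.countable_univ_iff.1 h

/-- The weight of an ideal of norm `exp t` in the Mertens function at `exp u`. -/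
def mertensWeight (t u : ℝ) : ℝ := if t < u then 1 else if t = u then 1 / 2 else 0

theorem measurable_mertensWeight (t : ℝ) : Measurable (mertensWeight t) :=
  Measurable.ite measurableSet_Ioi measurable_const
    (Measurable.ite (measurableSet_eq_fun measurable_const measurable_id) measurable_const
      measurable_const)

theorem mertensWeight_nonneg (t u : ℝ) : 0 ≤ mertensWeight t u := by
  unfold mertensWeight
  split_ifs <;> norm_num

theorem mertensWeight_le_exp {σ : ℝ} (hσ : 0 ≤ σ) (t u : ℝ) :
    mertensWeight t u ≤ Real.exp (σ * u) * Real.exp (-(σ * t)) := by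
  rw [← Real.exp_add]
  unfold mertensWeight
  split_ifs with h h'
  · exact Real.one_le_exp (by nlinarith)
  · subst h'
    simp only [add_neg_cancel, Real.exp_zero]
    norm_num
  · exact (Real.exp_pos _).le

theorem mertensWeight_ae_eq (t : ℝ) :
    ∀ᵐ u ∂volume.restrict (Set.Ioi (0 : ℝ)), mertensWeight t u = (Set.Ioi t).indicator 1 u := by
  filter_upwards [ae_restrict_of_ae (Measure.ae_ne volume t)] with u hu
  unfold mertensWeight
  by_cases h : t < u
  · simp [h]
  · simp [h, hu.symm]

theorem mertensK_exp_eq (u : ℝ) : mertensK K (Real.exp u) =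
    ∑' I : {I : Ideal (𝓞 K) // I ≠ ⊥},
      (moebiusK K I.1 : ℝ) * mertensWeight (Real.log (Ideal.absNorm I.1)) u := by
  rw [mertensK, ← tsum_subtype_eq_of_support_subset (s := {I : Ideal (𝓞 K) | I ≠ ⊥})]
  · refine tsum_congr fun I ↦ ?_
    have h := absNorm_pos_of_ne_bot K I
    have h1 : Real.log (Ideal.absNorm I.1) < u ↔ (Ideal.absNorm I.1 : ℝ) < Real.exp u :=
      Real.log_lt_iff_lt_exp h
    have h2 : Real.log (Ideal.absNorm I.1) = u ↔ (Ideal.absNorm I.1 : ℝ) = Real.exp u :=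
      ⟨fun h' ↦ by rw [← h', Real.exp_log h], fun h' ↦ by rw [h', Real.log_exp]⟩
    have h3 : I.1 ≠ ⊥ := I.2
    simp only [mertensWeight, h1, h2, h3, ne_eq, not_false_eq_true, true_and]
    split_ifs <;> ring
  · intro I hI h
    exact hI (by simp [show I = ⊥ by simpa using h])

theorem norm_mertens_term_le {σ : ℝ} (hσ : 0 ≤ σ) (I : {I : Ideal (𝓞 K) // I ≠ ⊥}) (u : ℝ) :
    ‖(moebiusK K I.1 : ℝ) * mertensWeight (Real.log (Ideal.absNorm I.1)) u‖ ≤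
      Real.exp (σ * u) * Real.exp (-(σ * Real.log (Ideal.absNorm I.1))) := by
  rw [norm_mul, Real.norm_eq_abs, Real.norm_of_nonneg (mertensWeight_nonneg _ _)]
  refine (mul_le_of_le_one_left (mertensWeight_nonneg _ _) (abs_moebiusK_le K I.1)).trans ?_
  exact mertensWeight_le_exp hσ _ _

theorem expBdd_mertensK {σ : ℝ} (hσ : 1 < σ) : ExpBdd σ fun u ↦ mertensK K (Real.exp u) := by
  have hs := summable_exp_log_absNorm K hσ
  have hle := fun (u : ℝ) I ↦ norm_mertens_term_le K (zero_le_one.trans hσ.le) I u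
  have hsum (u : ℝ) := Summable.of_norm_bounded (hs.mul_left (Real.exp (σ * u))) (hle u)
  simp_rw [mertensK_exp_eq]
  refine ⟨measurable_tsum_of_summable (fun I ↦ (measurable_mertensWeight _).const_mul _) hsum,
    ∑' I : {I : Ideal (𝓞 K) // I ≠ ⊥}, Real.exp (-(σ * Real.log (Ideal.absNorm I.1))),
    fun u _ ↦ ?_⟩
  refine (tsum_of_norm_bounded (hs.mul_left (Real.exp (σ * u))).hasSum (hle u)).trans_eq ?_
  rw [tsum_mul_left, mul_comm]

theorem integral_mertensWeight_mul_cexp {t : ℝ} (ht : 0 ≤ t) {s : ℂ} (hs : 0 < s.re) :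
    ∫ u in Set.Ioi (0 : ℝ), (mertensWeight t u : ℂ) * cexp (-(s * u)) =
      cexp (-(s * t)) / s := by
  have h : ∫ u in Set.Ioi (0 : ℝ), (mertensWeight t u : ℂ) * cexp (-(s * u)) =
      ∫ u in Set.Ioi (0 : ℝ), (Set.Ioi t).indicator (fun u : ℝ ↦ cexp (-s * u)) u := by
    refine integral_congr_ae ?_
    filter_upwards [mertensWeight_ae_eq t] with u hu
    rw [hu]
    by_cases h : u ∈ Set.Ioi t <;> simp [h]
  rw [h, setIntegral_indicator measurableSet_Ioi, Set.inter_eq_right.2 (Set.Ioi_subset_Ioi ht),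
    integral_exp_mul_complex_Ioi (by simpa using hs), neg_mul, neg_div_neg_eq]

theorem integrableOn_mertensWeight_mul_cexp (t : ℝ) {s : ℂ} (hs : 0 < s.re) :
    IntegrableOn (fun u : ℝ ↦ (mertensWeight t u : ℂ) * cexp (-(s * u))) (Set.Ioi 0) :=
  ExpBdd.integrableOn_cexp (a := 0) ⟨measurable_mertensWeight t, 1, fun u _ ↦ by
    simpa [abs_of_nonneg (mertensWeight_nonneg t u)] using
      mertensWeight_le_exp le_rfl t u⟩ hs

theorem mul_laplaceR_mertensK {s : ℂ} (hs : 1 < s.re) :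
    s * laplaceR (fun u ↦ mertensK K (Real.exp u)) s =
      ∑' I : {I : Ideal (𝓞 K) // I ≠ ⊥},
        (moebiusK K I.1 : ℂ) * (Ideal.absNorm I.1 : ℂ) ^ (-s) := by
  have hs0 : 0 < s.re := one_pos.trans hs
  have hs1 : s ≠ 0 := fun h ↦ by simp [h] at hs0
  have hlog (I : {I : Ideal (𝓞 K) // I ≠ ⊥}) : 0 ≤ Real.log (Ideal.absNorm I.1) :=
    Real.log_nonneg (one_le_absNorm_of_ne_bot K I)
  let F : {I : Ideal (𝓞 K) // I ≠ ⊥} → ℝ → ℂ := fun I u ↦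
    (moebiusK K I.1 : ℂ) * (mertensWeight (Real.log (Ideal.absNorm I.1)) u * cexp (-(s * u)))
  have hFi (I) : Integrable (F I) (volume.restrict (Set.Ioi 0)) :=
    (integrableOn_mertensWeight_mul_cexp _ hs0).const_mul _
  have hsr : 0 < (s.re : ℂ).re := by simpa using hs0
  have hle (I) : ∫ u in Set.Ioi (0 : ℝ), ‖F I u‖ ≤
      Real.exp (-(s.re * Real.log (Ideal.absNorm I.1))) / s.re := by
    have h1 := integral_mertensWeight_mul_cexp (hlog I) hsr
    have h2 : ∫ u in Set.Ioi (0 : ℝ), mertensWeight (Real.log (Ideal.absNorm I.1)) u *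
        Real.exp (-(s.re * u)) = Real.exp (-(s.re * Real.log (Ideal.absNorm I.1))) / s.re := by
      apply ofReal_injective
      refine Eq.trans integral_ofReal.symm ?_
      simpa using h1
    rw [← h2]
    have h3 := (integrableOn_mertensWeight_mul_cexp (Real.log (Ideal.absNorm I.1)) hs0).norm
    have h4 (u : ℝ) : ‖(mertensWeight (Real.log (Ideal.absNorm I.1)) u : ℂ) * cexp (-(s * u))‖ =
        mertensWeight (Real.log (Ideal.absNorm I.1)) u * Real.exp (-(s.re * u)) := by
      rw [norm_mul, norm_real, Real.norm_of_nonneg (mertensWeight_nonneg _ _), norm_exp]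
      simp
    simp_rw [h4] at h3
    refine integral_mono (hFi I).norm h3 fun u ↦ ?_
    simp only [F]
    rw [norm_mul, h4]
    refine mul_le_of_le_one_left (mul_nonneg (mertensWeight_nonneg _ _) (Real.exp_pos _).le) ?_
    have := abs_moebiusK_le K I.1
    rwa [← Real.norm_eq_abs, ← norm_real, ofReal_intCast] at this
  have hsum : Summable fun I ↦ ∫ u in Set.Ioi (0 : ℝ), ‖F I u‖ :=
    Summable.of_nonneg_of_le (fun I ↦ integral_nonneg fun u ↦ norm_nonneg _) hle
      ((summable_exp_log_absNorm K hs).div_const _)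
  have h := (hasSum_integral_of_summable_integral_norm hFi hsum).tsum_eq
  have hL : laplaceR (fun u ↦ mertensK K (Real.exp u)) s =
      ∫ u in Set.Ioi (0 : ℝ), ∑' I, F I u := by
    refine integral_congr_ae (ae_of_all _ fun u ↦ ?_)
    dsimp only [F]
    rw [mertensK_exp_eq, ofReal_tsum, ← tsum_mul_right]
    refine tsum_congr fun I ↦ ?_
    push_cast
    ring
  rw [hL, ← h, ← tsum_mul_left]
  refine tsum_congr fun I ↦ ?_
  simp only [F]
  rw [integral_const_mul, integral_mertensWeight_mul_cexp (hlog I) hs0, absNorm_cpow_eq_cexp]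
  field_simp

end MertensLaplace

section Pole

variable (K : Type) [Field K] [NumberField K]

theorem setIntegral_Ioi_comp_sub {E : Type*} [NormedAddCommGroup E] [NormedSpace ℝ E]
    {F : ℝ → E} (hF : ∀ v ≤ 0, F v = 0) {t : ℝ} (ht : 0 ≤ t) :
    ∫ u in Set.Ioi (0 : ℝ), F (u - t) = ∫ v in Set.Ioi (0 : ℝ), F v := by
  rw [setIntegral_eq_integral_of_forall_compl_eq_zero fun u hu ↦ hF _ ?_,
    setIntegral_eq_integral_of_forall_compl_eq_zero fun u hu ↦ hF _ ?_,
    integral_sub_right_eq_self]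
  · simpa using hu
  · have : u ≤ 0 := by simpa using hu
    linarith

theorem expBdd_comp_neg {ψ : ℝ → ℝ} (hψ : Continuous ψ) (hψc : HasCompactSupport ψ) (a : ℝ) :
    ExpBdd a fun v ↦ ψ (-v) := by
  have hc : Continuous fun v ↦ ψ (-v) * Real.exp (-(a * v)) := by fun_prop
  have hs : HasCompactSupport fun v ↦ ψ (-v) * Real.exp (-(a * v)) :=
    (hψc.comp_homeomorph (Homeomorph.neg ℝ)).mul_right
  obtain ⟨C, hC⟩ := hs.exists_bound_of_continuous hc
  refine ⟨by fun_prop, C, fun u _ ↦ ?_⟩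
  have h := hC u
  rw [norm_mul, Real.norm_eq_abs, Real.norm_eq_abs, Real.abs_exp, Real.exp_neg,
    ← div_eq_mul_inv, div_le_iff₀ (Real.exp_pos _)] at h
  exact h

theorem laplaceR_tsum_ideal {ψ : ℝ → ℝ} (hψ : Continuous ψ) (hψc : HasCompactSupport ψ)
    (hψn : ∀ t, 0 ≤ t → ψ t = 0) {s : ℂ} (hs : 1 < s.re) :
    laplaceR (fun u ↦ ∑' I : {I : Ideal (𝓞 K) // I ≠ ⊥}, ψ (Real.log (Ideal.absNorm I.1) - u)) s =
      (∑' I : {I : Ideal (𝓞 K) // I ≠ ⊥}, (Ideal.absNorm I.1 : ℂ) ^ (-s)) *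
        laplaceR (fun v ↦ ψ (-v)) s := by
  have hlog (I : {I : Ideal (𝓞 K) // I ≠ ⊥}) : 0 ≤ Real.log (Ideal.absNorm I.1) :=
    Real.log_nonneg (one_le_absNorm_of_ne_bot K I)
  let G : ℝ → ℂ := fun v ↦ (ψ (-v) : ℂ) * cexp (-(s * v))
  have hG : ∀ v ≤ 0, G v = 0 := fun v hv ↦ by simp [G, hψn (-v) (by linarith)]
  have hGc : Continuous G := by fun_prop
  have hGs : HasCompactSupport G :=
    ((hψc.comp_homeomorph (Homeomorph.neg ℝ)).comp_left (g := ((↑) : ℝ → ℂ)) rfl).mul_right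
  have hGi : Integrable G := hGc.integrable_of_hasCompactSupport hGs
  let F : {I : Ideal (𝓞 K) // I ≠ ⊥} → ℝ → ℂ := fun I u ↦
    cexp (-(s * Real.log (Ideal.absNorm I.1))) * G (u - Real.log (Ideal.absNorm I.1))
  have hFi (I) : Integrable (F I) (volume.restrict (Set.Ioi 0)) :=
    ((hGi.comp_sub_right _).const_mul _).integrableOn
  have hFn (I) : ∫ u in Set.Ioi (0 : ℝ), ‖F I u‖ =
      Real.exp (-(s.re * Real.log (Ideal.absNorm I.1))) * ∫ v in Set.Ioi (0 : ℝ), ‖G v‖ := by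
    simp only [F, norm_mul]
    rw [integral_const_mul, setIntegral_Ioi_comp_sub (F := fun v ↦ ‖G v‖)
      (fun v hv ↦ by simp [hG v hv]) (hlog I), norm_exp, neg_re, re_mul_ofReal]
  have hsum : Summable fun I ↦ ∫ u in Set.Ioi (0 : ℝ), ‖F I u‖ := by
    simp_rw [hFn]
    exact (summable_exp_log_absNorm K hs).mul_right _
  have h := (hasSum_integral_of_summable_integral_norm hFi hsum).tsum_eq
  have hL : laplaceR (fun u ↦ ∑' I : {I : Ideal (𝓞 K) // I ≠ ⊥},
      ψ (Real.log (Ideal.absNorm I.1) - u)) s = ∫ u in Set.Ioi (0 : ℝ), ∑' I, F I u := by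
    refine integral_congr_ae (ae_of_all _ fun u ↦ ?_)
    dsimp only [F, G]
    rw [ofReal_tsum, ← tsum_mul_right]
    refine tsum_congr fun I ↦ ?_
    rw [mul_left_comm, ← Complex.exp_add, neg_sub]
    congr 2
    push_cast
    ring
  rw [hL, ← h, ← tsum_mul_right]
  refine tsum_congr fun I ↦ ?_
  simp only [F]
  rw [integral_const_mul, setIntegral_Ioi_comp_sub hG (hlog I), absNorm_cpow_eq_cexp]
  rfl

theorem laplaceR_ne_zero_of_pos {f : ℝ → ℝ} {a : ℝ} (hf : ExpBdd a f) {σ : ℝ} (hσ : a < σ)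
    (h0 : ∀ u, 0 ≤ f u) {p q : ℝ} (hp : 0 ≤ p) (hpq : p < q) (hpos : ∀ u ∈ Set.Ioo p q, 0 < f u) :
    laplaceR f σ ≠ 0 := by
  have h : laplaceR f σ = ((∫ u in Set.Ioi (0 : ℝ), f u * Real.exp (-(σ * u)) : ℝ) : ℂ) := by
    refine Eq.trans (integral_congr_ae (ae_of_all _ fun u ↦ ?_)) (integral_ofReal (𝕜 := ℂ))
    simp
  rw [h, ofReal_ne_zero]
  refine ((setIntegral_pos_iff_support_of_nonneg_ae (ae_of_all _ fun u ↦
    mul_nonneg (h0 u) (Real.exp_pos _).le) (hf.integrableOn hσ)).2 ?_).ne'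
  refine lt_of_lt_of_le (b := volume (Set.Ioo p q)) (by simp [hpq]) (measure_mono fun u hu ↦ ?_)
  exact ⟨(mul_pos (hpos u hu) (Real.exp_pos _)).ne', hp.trans_lt hu.1⟩

/-- If `f` and `g` agree on a real interval to the right of `1`, they agree on a
punctured disc around `1`. -/
theorem eq_on_punctured_disc {f g : ℂ → ℂ} {δ : ℝ} (hδ : 0 < δ)
    (hf : ∀ s, s ≠ 1 → ‖s - 1‖ < δ → DifferentiableAt ℂ f s)
    (hg : ∀ s, s ≠ 1 → ‖s - 1‖ < δ → DifferentiableAt ℂ g s)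
    (h : ∀ σ : ℝ, 1 < σ → f σ = g σ) {s : ℂ} (hs1 : s ≠ 1) (hs : ‖s - 1‖ < δ) : f s = g s := by
  have hne (w : ℂ) : 1 + cexp (-w) ≠ 1 := by simp [Complex.exp_ne_zero]
  have hlt (w : ℂ) (hw : -Real.log δ < w.re) : ‖1 + cexp (-w) - 1‖ < δ := by
    rw [add_sub_cancel_left, norm_exp, neg_re, ← Real.lt_log_iff_exp_lt hδ]
    linarith
  have hd {k : ℂ → ℂ} (hk : ∀ s, s ≠ 1 → ‖s - 1‖ < δ → DifferentiableAt ℂ k s) :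
      DifferentiableOn ℂ (fun w ↦ k (1 + cexp (-w))) {w | -Real.log δ < w.re} := fun w hw ↦
    ((hk _ (hne w) (hlt w hw)).comp w (f := fun w ↦ 1 + cexp (-w))
      (by fun_prop)).differentiableWithinAt
  have hs0 : s - 1 ≠ 0 := sub_ne_zero.2 hs1
  have key := eq_of_differentiableOn_of_eq_ofReal (b := 0) (hd hf) (hd hg) (fun σ _ ↦ by
    have := h (1 + Real.exp (-σ)) (by linarith [Real.exp_pos (-σ)])
    push_cast at this
    exact this) (s := -Complex.log (s - 1)) (by
      rw [neg_re, log_re]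
      exact neg_lt_neg (Real.log_lt_log (norm_pos_iff.2 hs0) hs))
  simpa [Complex.exp_log hs0] using key

theorem exists_differentiable_sub_one_mul {Z : ℂ → ℂ} (hZ : IsDedekindZeta K Z) :
    ∃ Y : ℂ → ℂ, Differentiable ℂ Y ∧ Y 1 ≠ 0 ∧ ∀ s, s ≠ 1 → Y s = (s - 1) * Z s := by
  let φ : ContDiffBump (-1 : ℝ) := ⟨1 / 2, 1, by norm_num, by norm_num⟩
  have hψd : ContDiff ℝ 1 φ := φ.contDiff
  have hψc : HasCompactSupport φ := φ.hasCompactSupport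
  have hsupp (t : ℝ) (ht : 0 ≤ t) : φ t = 0 := φ.zero_of_le_dist (by
    rw [Real.dist_eq, sub_neg_eq_add]
    exact (le_abs_self _).trans' (by linarith))
  obtain ⟨c, C, hC⟩ := exists_abs_tsum_ideal_sub_le K hψd hψc fun t ↦ φ.nonneg
  set d : ℝ := (Module.finrank ℚ K : ℝ)⁻¹ with hd
  have hd0 : 0 < d := by
    have : 0 < Module.finrank ℚ K := Module.finrank_pos
    positivity
  let q : ℝ → ℝ := fun u ↦
    ∑' I : {I : Ideal (𝓞 K) // I ≠ ⊥}, φ (Real.log (Ideal.absNorm I.1) - u)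
  have hqm : Measurable q := measurable_tsum_of_summable
    (fun I ↦ (φ.continuous.comp (continuous_const.sub continuous_id)).measurable)
    fun u ↦ summable_of_hasFiniteSupport (hasFiniteSupport_ideal K hψc u)
  let r : ℝ → ℝ := fun u ↦ q u - c * Real.exp u
  have hr : ExpBdd (1 - d) r := ⟨by fun_prop, C, fun u hu ↦ hC u hu.le⟩
  have hψ (a : ℝ) := expBdd_comp_neg φ.continuous hψc a
  set P : ℂ → ℂ := laplaceR fun v ↦ φ (-v) with hP
  have hPd (s : ℂ) : DifferentiableAt ℂ P s :=
    (hψ (s.re - 1)).differentiableOn_laplaceR.differentiableAt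
      ((isOpen_lt continuous_const continuous_re).mem_nhds (by simp))
  have hRd (s : ℂ) (hs : 1 - d < s.re) : DifferentiableAt ℂ (laplaceR r) s :=
    hr.differentiableOn_laplaceR.differentiableAt
      ((isOpen_lt continuous_const continuous_re).mem_nhds hs)
  have hP1 : P 1 ≠ 0 := by
    have := laplaceR_ne_zero_of_pos (hψ 0) one_pos (fun u ↦ φ.nonneg) le_rfl two_pos
      fun u hu ↦ φ.pos_of_mem_ball (by
        rw [Metric.mem_ball, Real.dist_eq, abs_lt]
        constructor <;> simp only [φ] <;> linarith [hu.1, hu.2])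
    rwa [ofReal_one] at this
  let W : ℂ → ℂ := fun s ↦ c + (s - 1) * laplaceR r s
  have hre (s : ℂ) (hs : ‖s - 1‖ < d) : 1 - d < s.re := by
    have h1 := (abs_re_le_norm (s - 1)).trans_lt hs
    rw [sub_re, one_re] at h1
    linarith [(abs_lt.1 h1).1]
  have hWd (s : ℂ) (hs : ‖s - 1‖ < d) : DifferentiableAt ℂ W s :=
    (differentiableAt_const _).add
      ((differentiableAt_id.sub_const _).mul (hRd s (hre s hs)))
  have hW (σ : ℝ) (hσ : 1 < σ) : ((σ : ℂ) - 1) * Z σ * P σ = W σ := by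
    have hσ' : 1 < (σ : ℂ).re := by simpa
    have h1 := laplaceR_tsum_ideal K φ.continuous hψc hsupp hσ'
    rw [← hZ.2 _ hσ'] at h1
    obtain ⟨b, hb1, hbσ⟩ := exists_between hσ
    have he := expBdd_pow_mul_exp 0 hb1
    have h2 := (hr.mono (by linarith)).laplaceR_add (he.const_mul c) (s := σ) (by simpa)
    rw [laplaceR_const_mul, laplaceR_pow_mul_exp 0 (by simpa)] at h2
    have h3 : (fun u ↦ r u + c * (u ^ 0 * Real.exp (1 * u))) = q := by
      funext u
      simp [r]
    rw [h3] at h2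
    have hne : (σ : ℂ) - 1 ≠ 0 := sub_ne_zero.2 (by exact_mod_cast hσ.ne')
    rw [mul_assoc, ← h1, show laplaceR _ (σ : ℂ) = _ from h2]
    simp only [W]
    push_cast
    simp only [Nat.factorial_zero, pow_one, Nat.cast_one]
    field_simp
    ring
  have heq (s : ℂ) (hs1 : s ≠ 1) (hs : ‖s - 1‖ < d) : (s - 1) * Z s * P s = W s :=
    eq_on_punctured_disc hd0 (f := fun s ↦ (s - 1) * Z s * P s)
      (fun s hs _ ↦ ((differentiableAt_id.sub_const _).mul (hZ.1 s hs)).mul (hPd s))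
      (fun s _ hs ↦ hWd s hs) hW hs1 hs
  have hnear : ∀ᶠ s : ℂ in 𝓝[≠] 1, (s - 1) * Z s = W s / P s := by
    filter_upwards [self_mem_nhdsWithin, nhdsWithin_le_nhds (Metric.ball_mem_nhds 1 hd0),
      nhdsWithin_le_nhds ((hPd 1).continuousAt.eventually_ne hP1)] with s hs1 hs hPs
    rw [eq_div_iff hPs, heq s hs1 (by rwa [← dist_eq_norm])]
  have hlim : Tendsto (fun s : ℂ ↦ (s - 1) * Z s) (𝓝[≠] 1) (𝓝 (W 1 / P 1)) :=
    (((hWd 1 (by simpa)).div (hPd 1) hP1).continuousAt.tendsto.mono_left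
      nhdsWithin_le_nhds).congr' (hnear.mono fun s hs ↦ hs.symm)
  have hres : W 1 / P 1 = dedekindZeta_residue K := by
    have ht : Tendsto (fun t : ℝ ↦ (t : ℂ)) (𝓝[>] 1) (𝓝[≠] (1 : ℂ)) := by
      refine tendsto_nhdsWithin_iff.2
        ⟨((continuous_ofReal.tendsto 1).mono_left nhdsWithin_le_nhds), ?_⟩
      filter_upwards [self_mem_nhdsWithin] with t ht
      simpa using (Set.mem_Ioi.1 ht).ne'
    refine tendsto_nhds_unique (hlim.comp ht)
      ((tendsto_sub_one_mul_dedekindZeta_nhdsGT K).congr' ?_)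
    filter_upwards [self_mem_nhdsWithin] with t ht
    have ht' : 1 < (t : ℂ).re := by simpa using ht
    simp [hZ.2 _ ht', tsum_absNorm_cpow K ht']
  refine ⟨Function.update (fun s ↦ (s - 1) * Z s) 1 (W 1 / P 1), fun s ↦ ?_, ?_, fun s hs ↦ ?_⟩
  · rcases eq_or_ne s 1 with rfl | hs
    · refine (analyticAt_of_differentiable_on_punctured_nhds_of_continuousAt ?_
        (continuousAt_update_same.2 hlim)).differentiableAt
      filter_upwards [self_mem_nhdsWithin] with s hs
      refine DifferentiableAt.congr_of_eventuallyEq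
        ((differentiableAt_id.sub_const 1).mul (hZ.1 s hs)) ?_
      filter_upwards [isOpen_ne.mem_nhds hs] with z hz
      simp [Function.update_of_ne hz]
    · refine DifferentiableAt.congr_of_eventuallyEq
        ((differentiableAt_id.sub_const 1).mul (hZ.1 s hs)) ?_
      filter_upwards [isOpen_ne.mem_nhds hs] with z hz
      simp [Function.update_of_ne hz]
  · rw [Function.update_self, hres]
    exact_mod_cast dedekindZeta_residue_ne_zero K
  · rw [Function.update_of_ne hs]

end Pole

section Domination

variable (K : Type) [Field K] [NumberField K]

open ProbabilityTheory in
/-- Landau's theorem for Laplace transforms: a nonnegative function whose Laplace transform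
continues meromorphically without real poles to `Re s > a` has a Laplace transform there,
which is dominated by its values on the real axis. -/
theorem mul_laplaceR_eq_and_norm_le {H : ℝ → ℝ} {a b : ℝ} (hH : ExpBdd b H)
    (hH0 : ∀ u, 0 < u → 0 ≤ H u) {D N : ℂ → ℂ}
    (hD : DifferentiableOn ℂ D {s | a < s.re}) (hN : DifferentiableOn ℂ N {s | a < s.re})
    (h : ∀ s : ℂ, b < s.re → D s * laplaceR H s = N s) (hD0 : ∀ σ : ℝ, a < σ → D σ ≠ 0) :
    (∀ s : ℂ, a < s.re → D s * laplaceR H s = N s) ∧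
      ∀ s : ℂ, ‖laplaceR H s‖ ≤ ‖laplaceR H s.re‖ := by
  simp_rw [← complexMGF_laplaceMeasure hH.1 hH0] at h ⊢
  have hb : Set.Ioi b ⊆ integrableExpSet (fun u ↦ -u) (laplaceMeasure H) := fun σ hσ ↦
    (mem_integrableExpSet_laplaceMeasure hH.1 hH0).2 (hH.integrableOn hσ)
  have ha := landau_Ioi_subset_integrableExpSet measurable_neg (ae_neg_le_zero_laplaceMeasure H)
    hb hD hN h hD0
  refine ⟨mul_complexMGF_eq_of_Ioi_subset le_rfl hD hN h ha, fun s ↦ ?_⟩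
  rw [complexMGF_ofReal, norm_real]
  exact norm_complexMGF_le_mgf.trans (le_abs_self _)

variable {K}

theorem IsDedekindZeta.ne_zero_of_one_lt_re {Z : ℂ → ℂ} (hZ : IsDedekindZeta K Z) {s : ℂ}
    (hs : 1 < s.re) : Z s ≠ 0 := by
  rw [hZ.2 s hs]
  exact left_ne_zero_of_mul_eq_one (tsum_absNorm_cpow_mul_tsum_moebiusK K hs)

theorem IsDedekindZeta.laplaceR_mertensK {Z : ℂ → ℂ} (hZ : IsDedekindZeta K Z) {s : ℂ}
    (hs : 1 < s.re) : laplaceR (fun u ↦ mertensK K (Real.exp u)) s = 1 / (s * Z s) := by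
  have hs0 : s ≠ 0 := fun h ↦ by simp [h] at hs; linarith
  have h1 := mul_laplaceR_mertensK K hs
  have h2 := tsum_absNorm_cpow_mul_tsum_moebiusK K hs
  rw [← h1, ← hZ.2 s hs] at h2
  rw [eq_div_iff (mul_ne_zero hs0 (hZ.ne_zero_of_one_lt_re hs))]
  linear_combination h2

theorem IsDedekindZeta.im_ofReal {Z : ℂ → ℂ} (hZ : IsDedekindZeta K Z) {σ : ℝ} (hσ : σ ≠ 1) :
    (Z σ).im = 0 := by
  obtain ⟨Y, hY, -, hYZ⟩ := exists_differentiable_sub_one_mul K hZ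
  have hc : Differentiable ℂ fun s ↦ (starRingEnd ℂ) (Y ((starRingEnd ℂ) s)) := fun s ↦
    differentiableAt_conj_conj_iff.2 (hY _)
  have h := eq_of_differentiableOn_of_eq_ofReal (a := σ - 1) (b := 1) hY.differentiableOn
    hc.differentiableOn (fun t ht ↦ by
      have ht' : 1 < (t : ℂ).re := by simpa using ht
      have ht1 : (t : ℂ) ≠ 1 := by exact_mod_cast ht.ne'
      rw [conj_ofReal, hYZ _ ht1, hZ.2 _ ht', map_mul, conj_tsum]
      congr 1
      · simp
      · refine tsum_congr fun I ↦ ?_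
        rw [absNorm_cpow_eq_cexp, ← exp_conj]
        simp [-natCast_log]) (s := σ) (by simp)
  rw [conj_ofReal, eq_comm, conj_eq_iff_im, hYZ _ (by exact_mod_cast hσ)] at h
  have h1 : ((σ : ℂ) - 1) = ((σ - 1 : ℝ) : ℂ) := by push_cast; rfl
  rw [h1, im_ofReal_mul, mul_eq_zero] at h
  exact h.resolve_left (sub_ne_zero.2 hσ)

theorem exists_dominated_transform {Z : ℂ → ℂ} (hZ : IsDedekindZeta K Z) (hRH : ZetaRH Z)
    {A : ℝ → ℝ} (hA : ExpBdd 2 A) {P : ℂ → ℂ} (hP : DifferentiableOn ℂ P {s | 1 / 2 < s.re})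
    (hAP : ∀ s : ℂ, 2 < s.re → laplaceR A s = 1 / (s * Z s) - P s)
    {τ ε : ℝ} (hτ : |τ| = 1) (hε : 0 < ε) (k : ℕ)
    (hev : ∀ᶠ u in atTop, τ * A u ≤ ε * (u ^ k * Real.exp (1 / 2 * u))) :
    ∃ T E : ℂ → ℂ, Continuous E ∧ (∀ s : ℂ, ‖T s‖ ≤ ‖T s.re‖) ∧
      ∀ s : ℂ, 1 / 2 < s.re → s.re < 1 →
        T s = ε * (k.factorial / (s - 1 / 2) ^ (k + 1)) - τ * (1 / (s * Z s) - P s) + E s := by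
  obtain ⟨Y, hY, hY1, hYZ⟩ := exists_differentiable_sub_one_mul K hZ
  have hYne {s : ℂ} (hs : 1 / 2 < s.re) (h : s.re < 1 ∨ 1 < s.re ∨ s = 1) : Y s ≠ 0 := by
    rcases h with h | h | rfl
    · have h1 : s ≠ 1 := fun h' ↦ by simp [h'] at h
      rw [hYZ s h1]
      exact mul_ne_zero (sub_ne_zero.2 h1) fun h' ↦
        hs.ne' (hRH s h' (by linarith) h)
    · have h1 : s ≠ 1 := fun h' ↦ by simp [h'] at h
      rw [hYZ s h1]
      exact mul_ne_zero (sub_ne_zero.2 h1) (hZ.ne_zero_of_one_lt_re h)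
    · exact hY1
  obtain ⟨u₀, hu₀⟩ := eventually_atTop.1 hev
  obtain ⟨hAm, C, hC⟩ := id hA
  let B : ℝ := |C| * Real.exp (2 * u₀)
  let J : ℝ → ℝ := fun u ↦ B * (Set.Iic u₀).indicator 1 u
  have hJ (a : ℝ) : ExpBdd a J := by
    refine ExpBdd.const_mul ⟨measurable_one.indicator measurableSet_Iic,
      Real.exp (|a| * |u₀|), fun u hu ↦ ?_⟩ B
    rw [← Real.exp_add]
    by_cases h : u ∈ Set.Iic u₀
    · rw [Set.indicator_of_mem h, Pi.one_apply, abs_one]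
      refine Real.one_le_exp ?_
      have h1 : u ≤ |u₀| := (Set.mem_Iic.1 h).trans (le_abs_self _)
      nlinarith [neg_abs_le a, mul_le_mul_of_nonneg_left h1 (abs_nonneg a)]
    · rw [Set.indicator_of_notMem h, abs_zero]
      exact (Real.exp_pos _).le
  have hE : Differentiable ℂ (laplaceR J) := fun s ↦
    (hJ (s.re - 1)).differentiableOn_laplaceR.differentiableAt
      ((isOpen_lt continuous_const continuous_re).mem_nhds (by simp))
  have hm := (expBdd_pow_mul_exp k (b := 1 / 2) (c := 2) (by norm_num)).const_mul ε
  let H : ℝ → ℝ := fun u ↦ (ε * (u ^ k * Real.exp (1 / 2 * u)) + (-τ) * A u) + J u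
  have hH : ExpBdd 2 H := (hm.add (hA.const_mul (-τ))).add (hJ 2)
  have hH0 (u : ℝ) (hu : 0 < u) : 0 ≤ H u := by
    have hmain : 0 ≤ ε * (u ^ k * Real.exp (1 / 2 * u)) := by positivity
    by_cases h : u ∈ Set.Iic u₀
    · have h1 : |A u| ≤ B := (hC u hu).trans (mul_le_mul (le_abs_self C)
        (Real.exp_le_exp.2 (by linarith [Set.mem_Iic.1 h])) (Real.exp_pos _).le (abs_nonneg C))
      have h2 : |τ * A u| = |A u| := by rw [abs_mul, hτ, one_mul]
      have h3 : J u = B := by simp only [J]; rw [Set.indicator_of_mem h]; simp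
      simp only [H]
      rw [h3]
      linarith [le_abs_self (τ * A u)]
    · have h3 : J u = 0 := by simp only [J]; rw [Set.indicator_of_notMem h]; simp
      simp only [H]
      rw [h3]
      linarith [hu₀ u (by simpa using (not_le.1 h).le)]
  have hHL (s : ℂ) (hs : 2 < s.re) : laplaceR H s =
      ε * (k.factorial / (s - 1 / 2) ^ (k + 1)) - τ * (1 / (s * Z s) - P s) + laplaceR J s := by
    have h1 := ((hm.add (hA.const_mul (-τ))).laplaceR_add (hJ 2) hs)
    rw [hm.laplaceR_add (hA.const_mul (-τ)) hs, laplaceR_const_mul, laplaceR_const_mul,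
      laplaceR_pow_mul_exp k (by linarith), hAP s hs] at h1
    rw [show laplaceR H s = _ from h1]
    push_cast
    ring
  have hne {s : ℂ} (hs : 1 / 2 < s.re) : s - 1 / 2 ≠ 0 := fun h ↦ by
    have := congrArg re h
    simp at this
    norm_num at hs
    linarith
  have hne0 {s : ℂ} (hs : 1 / 2 < s.re) : s ≠ 0 := fun h ↦ by
    simp [h] at hs
    linarith
  obtain ⟨h1, h2⟩ := mul_laplaceR_eq_and_norm_le (a := 1 / 2) hH hH0 (D := fun s ↦ s * Y s)
    (N := fun s ↦ (ε * (k.factorial / (s - 1 / 2) ^ (k + 1)) + τ * P s + laplaceR J s) *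
      (s * Y s) - τ * (s - 1)) (differentiable_id.mul hY).differentiableOn
    (by
      refine DifferentiableOn.sub (DifferentiableOn.mul (DifferentiableOn.add
        (DifferentiableOn.add (DifferentiableOn.const_mul ?_ _) (hP.const_mul _))
        hE.differentiableOn) (differentiable_id.mul hY).differentiableOn) (by fun_prop)
      exact DifferentiableOn.div (by fun_prop) (by fun_prop)
        fun z hz ↦ pow_ne_zero _ (hne hz))
    (fun s hs ↦ by
      have hs1 : s ≠ 1 := fun h ↦ by simp [h] at hs
      have hZs := hZ.ne_zero_of_one_lt_re (s := s) (by linarith)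
      have hs0 := hne0 (s := s) (by linarith)
      rw [hHL s hs, hYZ s hs1]
      field_simp
      ring)
    (fun σ hσ ↦ by
      refine mul_ne_zero (hne0 (by simpa using hσ)) (hYne (by simpa using hσ) ?_)
      rcases lt_trichotomy σ 1 with h | h | h
      · exact Or.inl (by simpa using h)
      · exact Or.inr (Or.inr (by simp [h]))
      · exact Or.inr (Or.inl (by simpa using h)))
  refine ⟨laplaceR H, laplaceR J, hE.continuous, h2, fun s hs hs1 ↦ ?_⟩
  have hY0 := hYne hs (Or.inl hs1)
  have hs1' : s ≠ 1 := fun h ↦ by simp [h] at hs1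
  have hs0 := hne0 hs
  refine mul_left_cancel₀ (mul_ne_zero hs0 hY0) ((h1 s hs).trans ?_)
  have hZs : Z s ≠ 0 := fun h ↦ hY0 (by rw [hYZ s hs1', h, mul_zero])
  rw [hYZ s hs1']
  field_simp
  ring

end Domination

section Omega

variable {K : Type} [Field K] [NumberField K]

theorem exists_eq_sub_pow_mul_of_iteratedDeriv {f : ℂ → ℂ} {z₀ : ℂ} (hf : AnalyticAt ℂ f z₀)
    {m : ℕ} (h0 : ∀ j < m, iteratedDeriv j f z₀ = 0) (hm : iteratedDeriv m f z₀ ≠ 0) :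
    ∃ g : ℂ → ℂ, AnalyticAt ℂ g z₀ ∧ g z₀ ≠ 0 ∧ ∀ᶠ z in 𝓝 z₀, f z = (z - z₀) ^ m * g z := by
  refine (hf.analyticOrderAt_eq_natCast (n := m)).1 (le_antisymm ?_
    ((natCast_le_analyticOrderAt_iff_iteratedDeriv_eq_zero hf).2 h0))
  by_contra! h
  have h1 : ((m + 1 : ℕ) : ℕ∞) ≤ analyticOrderAt f z₀ := by
    push_cast
    exact Order.add_one_le_of_lt h
  exact hm ((natCast_le_analyticOrderAt_iff_iteratedDeriv_eq_zero hf).1 h1 m (Nat.lt_succ_self m))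

/-- The difference of the Mertens function and its correction term, in the logarithmic scale. -/
def mertensRemainder (K : Type) [Field K] [NumberField K] (m₀ : ℕ) (c : ℕ → ℂ) (u : ℝ) : ℝ :=
  mertensK K (Real.exp u) + ∑ k ∈ Finset.Icc 1 m₀,
    (-((c k).re / (k - 1).factorial)) * (u ^ (k - 1) * Real.exp (1 / 2 * u))

theorem expBdd_mertensRemainder (m₀ : ℕ) (c : ℕ → ℂ) : ExpBdd 2 (mertensRemainder K m₀ c) :=
  (expBdd_mertensK K one_lt_two).add (ExpBdd.sum _ fun k _ ↦
    (expBdd_pow_mul_exp (k - 1) (by norm_num)).const_mul _)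

theorem laplaceR_mertensRemainder {Z : ℂ → ℂ} (hZ : IsDedekindZeta K Z) (m₀ : ℕ) (c : ℕ → ℂ)
    {s : ℂ} (hs : 2 < s.re) : laplaceR (mertensRemainder K m₀ c) s =
      1 / (s * Z s) - ∑ k ∈ Finset.Icc 1 m₀, (c k).re / (s - 1 / 2) ^ k := by
  have hs' (k : ℕ) : ExpBdd 2 fun u ↦ (-((c k).re / (k - 1).factorial)) *
      (u ^ (k - 1) * Real.exp (1 / 2 * u)) :=
    (expBdd_pow_mul_exp (k - 1) (by norm_num)).const_mul _
  have h := (expBdd_mertensK K one_lt_two).laplaceR_add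
    (ExpBdd.sum (Finset.Icc 1 m₀) fun k _ ↦ hs' k) hs
  refine Eq.trans h ?_
  rw [hZ.laplaceR_mertensK (by linarith), ExpBdd.laplaceR_sum _ (fun k _ ↦ hs' k) hs,
    sub_eq_add_neg, ← Finset.sum_neg_distrib]
  congr 1
  refine Finset.sum_congr rfl fun k hk ↦ ?_
  rw [laplaceR_const_mul, laplaceR_pow_mul_exp (k - 1) (by linarith),
    Nat.sub_add_cancel (Finset.mem_Icc.1 hk).1]
  have : ((k - 1).factorial : ℂ) ≠ 0 := by exact_mod_cast Nat.factorial_ne_zero _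
  push_cast
  field_simp

theorem exists_pos_forall_not_eventually_le {Z : ℂ → ℂ} (hZ : IsDedekindZeta K Z)
    (hRH : ZetaRH Z) {γ : ℝ} (hγ : 0 < γ) {m : ℕ} (hm : 1 ≤ m)
    (hmult : (∀ j : ℕ, j < m → iteratedDeriv j Z (1 / 2 + γ * Complex.I) = 0) ∧
      iteratedDeriv m Z (1 / 2 + γ * Complex.I) ≠ 0)
    {m₀ : ℕ} {c : ℕ → ℂ} (hc : ∃ g : ℂ → ℂ, AnalyticAt ℂ g ((1 : ℂ) / 2) ∧
      ∀ᶠ s in 𝓝[≠] ((1 : ℂ) / 2),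
        1 / (s * Z s) = (∑ k ∈ Finset.Icc 1 m₀, c k / (s - 1 / 2) ^ k) + g s) :
    ∃ ε : ℝ, 0 < ε ∧ ∀ τ : ℝ, |τ| = 1 → ¬ ∀ᶠ u in atTop,
      τ * mertensRemainder K m₀ c u ≤ ε * (u ^ (m - 1) * Real.exp (1 / 2 * u)) := by
  set ρ : ℂ := 1 / 2 + γ * Complex.I with hρ
  have hρre : ρ.re = 1 / 2 := by simp [hρ]
  have hρ0 : ρ ≠ 0 := fun h ↦ by simp [h] at hρre
  have hρ1 : ρ ≠ 1 := fun h ↦ by norm_num [h] at hρre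
  have hρ2 : ρ - 1 / 2 ≠ 0 := by simp [hρ, hγ.ne']
  have hZd : DifferentiableOn ℂ Z {1}ᶜ := fun s hs ↦ (hZ.1 s hs).differentiableWithinAt
  obtain ⟨q, hqa, hq0, hq⟩ := exists_eq_sub_pow_mul_of_iteratedDeriv
    (hZd.analyticAt (isOpen_compl_singleton.mem_nhds hρ1)) hmult.1 hmult.2
  obtain ⟨g, hga, hg⟩ := hc
  have hf : (0 : ℝ) < (m - 1).factorial := by exact_mod_cast Nat.factorial_pos _
  have hκ : 0 < ‖ρ * q ρ‖ := norm_pos_iff.2 (mul_ne_zero hρ0 hq0)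
  refine ⟨1 / (2 * ‖ρ * q ρ‖ * (m - 1).factorial), by positivity, fun τ hτ hev ↦ ?_⟩
  set ε : ℝ := 1 / (2 * ‖ρ * q ρ‖ * (m - 1).factorial) with hε
  have hε0 : 0 < ε := by positivity
  set P : ℂ → ℂ := fun s ↦ ∑ k ∈ Finset.Icc 1 m₀, (c k).re / (s - 1 / 2) ^ k with hPdef
  have hPd (s : ℂ) (hs : s - 1 / 2 ≠ 0) : DifferentiableAt ℂ P s := by
    refine DifferentiableAt.fun_sum fun k _ ↦ ?_
    exact DifferentiableAt.div (by fun_prop) (by fun_prop) (pow_ne_zero _ hs)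
  have hne {s : ℂ} (hs : 1 / 2 < s.re) : s - 1 / 2 ≠ 0 := fun h ↦ by
    rw [sub_eq_zero.1 h] at hs
    norm_num at hs
  obtain ⟨T, E, hE, hT, hTeq⟩ := exists_dominated_transform hZ hRH
    (expBdd_mertensRemainder m₀ c) (P := P)
    (fun s hs ↦ (hPd s (hne hs)).differentiableWithinAt)
    (fun s hs ↦ laplaceR_mertensRemainder hZ m₀ c hs) hτ hε0 (m - 1) hev
  rw [Nat.sub_add_cancel hm] at hTeq
  have hIoo : ∀ᶠ σ : ℝ in 𝓝[>] (1 / 2), 1 / 2 < σ ∧ σ < 1 :=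
    Ioo_mem_nhdsGT (by norm_num)
  have htr : Tendsto (fun σ : ℝ ↦ (σ : ℂ)) (𝓝[>] (1 / 2)) (𝓝[≠] ((1 : ℂ) / 2)) := by
    refine tendsto_nhdsWithin_iff.2 ⟨?_, ?_⟩
    · have := (continuous_ofReal.tendsto (1 / 2)).mono_left
        (nhdsWithin_le_nhds (s := Set.Ioi (1 / 2 : ℝ)))
      simpa using this
    · filter_upwards [self_mem_nhdsWithin] with σ hσ h
      have := congrArg re h
      norm_num at this
      norm_num at hσ
      linarith
  have htρ : Tendsto (fun σ : ℝ ↦ (σ : ℂ) + γ * Complex.I) (𝓝[>] (1 / 2)) (𝓝 ρ) :=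
    (htr.mono_right nhdsWithin_le_nhds).add_const _
  have hreal : Tendsto (fun σ : ℝ ↦ ((σ : ℂ) - 1 / 2) ^ m * T σ) (𝓝[>] (1 / 2))
      (𝓝 (ε * (m - 1).factorial)) := by
    have hcont : ContinuousAt (fun s : ℂ ↦ (ε : ℂ) * (m - 1).factorial -
        τ * ((s - 1 / 2) ^ m * ((g s).re : ℂ)) + (s - 1 / 2) ^ m * E s) (1 / 2) := by
      have h1 : ContinuousAt (fun s ↦ ((g s).re : ℂ)) (1 / 2) :=
        (continuous_ofReal.comp continuous_re).continuousAt.comp hga.continuousAt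
      have h2 := hE.continuousAt (x := 1 / 2)
      fun_prop
    have hlim := hcont.tendsto.comp (htr.mono_right nhdsWithin_le_nhds)
    simp only [sub_self, zero_pow (by omega : m ≠ 0), zero_mul, mul_zero, sub_zero,
      add_zero] at hlim
    refine hlim.congr' ?_
    filter_upwards [hIoo, htr.eventually hg] with σ hσ hgσ
    have hs := hne (s := σ) (by simpa using hσ.1)
    have hre : 1 / ((σ : ℂ) * Z σ) - P σ = ((g σ).re : ℂ) := by
      have hr : (1 / ((σ : ℂ) * Z σ)) = ((1 / ((σ : ℂ) * Z σ)).re : ℂ) := by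
        rw [eq_comm, ← conj_eq_iff_re]
        have := conj_eq_iff_im.2 (hZ.im_ofReal hσ.2.ne)
        rw [map_div₀, map_mul, conj_ofReal, this, map_one]
      rw [hr, hgσ, add_re, re_sum, ofReal_add, ofReal_sum, add_sub_right_comm, hPdef]
      have : ∀ k ∈ Finset.Icc 1 m₀, ((c k / ((σ : ℂ) - 1 / 2) ^ k).re : ℂ) =
          (c k).re / ((σ : ℂ) - 1 / 2) ^ k := fun k _ ↦ by
        have h : ((σ : ℂ) - 1 / 2) ^ k = (((σ - 1 / 2) ^ k : ℝ) : ℂ) := by push_cast; rfl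
        rw [h, div_ofReal_re, ofReal_div]
      rw [Finset.sum_congr rfl this, sub_self, zero_add]
    rw [Function.comp_apply, hTeq σ (by simpa using hσ.1) (by simpa using hσ.2), hre]
    have hw : ((σ : ℂ) - 1 / 2) ^ m ≠ 0 := pow_ne_zero m hs
    generalize ((σ : ℂ) - 1 / 2) ^ m = w at hw ⊢
    field_simp
  have hcomplex : Tendsto (fun σ : ℝ ↦ ((σ : ℂ) - 1 / 2) ^ m * T (σ + γ * Complex.I))
      (𝓝[>] (1 / 2)) (𝓝 (-(τ * (1 / (ρ * q ρ))))) := by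
    have hcont : ContinuousAt (fun s : ℂ ↦
        (s - ρ) ^ m * (ε * ((m - 1).factorial / (s - 1 / 2) ^ m) + τ * P s + E s) -
          τ * (1 / (s * q s))) ρ := by
      have h1 := (hPd ρ hρ2).continuousAt
      have h2 := hE.continuousAt (x := ρ)
      have h3 : ContinuousAt (fun s : ℂ ↦ ((m - 1).factorial : ℂ) / (s - 1 / 2) ^ m) ρ :=
        ContinuousAt.div (by fun_prop) (by fun_prop) (pow_ne_zero _ hρ2)
      have h4 : ContinuousAt (fun s : ℂ ↦ 1 / (s * q s)) ρ :=
        continuousAt_const.div (continuousAt_id.mul hqa.continuousAt) (mul_ne_zero hρ0 hq0)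
      fun_prop
    have hlim := hcont.tendsto.comp htρ
    simp only [sub_self, zero_pow (by omega : m ≠ 0), zero_mul, zero_sub] at hlim
    refine hlim.congr' ?_
    filter_upwards [hIoo, htρ.eventually hq, htρ.eventually (hqa.continuousAt.eventually_ne hq0)]
      with σ hσ hqσ hqσ0
    have hsub : (σ : ℂ) + γ * Complex.I - ρ = σ - 1 / 2 := by rw [hρ]; ring
    have hs := hne (s := σ) (by simpa using hσ.1)
    rw [Function.comp_apply, hTeq _ (by simpa using hσ.1) (by simpa using hσ.2), hqσ, hsub]
    have hs0 : (σ : ℂ) + γ * Complex.I ≠ 0 := fun h ↦ by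
      have := congrArg re h
      simp at this
      norm_num [this] at hσ
    have hw : ((σ : ℂ) - 1 / 2) ^ m ≠ 0 := pow_ne_zero m hs
    generalize ((σ : ℂ) - 1 / 2) ^ m = w at hw ⊢
    field_simp
    ring
  have hle := le_of_tendsto_of_tendsto' hcomplex.norm hreal.norm fun σ ↦ by
    rw [norm_mul, norm_mul]
    refine mul_le_mul_of_nonneg_left ?_ (norm_nonneg _)
    simpa using hT (σ + γ * Complex.I)
  rw [norm_neg, norm_mul (τ : ℂ), norm_div, norm_one, norm_real, Real.norm_eq_abs, hτ, one_mul,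
    norm_mul (ε : ℂ), norm_real, Real.norm_of_nonneg hε0.le, norm_natCast, hε] at hle
  have : 1 / (2 * ‖ρ * q ρ‖ * (m - 1).factorial) * (m - 1).factorial = 1 / ‖ρ * q ρ‖ / 2 := by
    field_simp
  rw [this] at hle
  have : 0 < 1 / ‖ρ * q ρ‖ := by positivity
  linarith

theorem mertensRemainder_eq (m₀ : ℕ) (c : ℕ → ℂ) (u : ℝ) : mertensRemainder K m₀ c u =
    mertensK K (Real.exp u) - ∑ k ∈ Finset.Icc 1 m₀,
      (c k).re * Real.sqrt (Real.exp u) * Real.log (Real.exp u) ^ (k - 1) /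
        (Nat.factorial (k - 1)) := by
  rw [mertensRemainder, sub_eq_add_neg, ← Finset.sum_neg_distrib]
  congr 1
  refine Finset.sum_congr rfl fun k _ ↦ ?_
  rw [Real.log_exp, ← Real.exp_half, div_eq_inv_mul u 2, one_div]
  ring

end Omega

/-- **Corollary 2.10.** Assume the Riemann hypothesis for `ζ_K`, and suppose `ζ_K` has a
zero `ρ = 1/2 + iγ` with `γ > 0` of multiplicity `m ≥ 1`. Let `M̃_K` be the correction
term coming from the principal part of `1/(s ζ_K(s))` at a possible zero at `s = 1/2`
(with `M̃_K = 0` if `ζ_K(1/2) ≠ 0`). Then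
`M_K(x) - M̃_K(x) = Ω_±(x^{1/2} (log x)^{m-1})`. -/
theorem omega_pm_RH_multiple_zero
    (K : Type) [Field K] [NumberField K]
    (Z : ℂ → ℂ) (hZ : IsDedekindZeta K Z) (hRH : ZetaRH Z)
    (γ : ℝ) (hγ : 0 < γ)
    (m : ℕ) (hm : 1 ≤ m)
    (hmult : (∀ j : ℕ, j < m → iteratedDeriv j Z (1 / 2 + γ * Complex.I) = 0) ∧
      iteratedDeriv m Z (1 / 2 + γ * Complex.I) ≠ 0)
    -- the multiplicity `m₀` of a possible zero at `s = 1/2` and the principal-part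
    -- coefficients `c k` of `1/(s ζ_K(s))` at `s = 1/2` (`m₀ = 0` if `ζ_K(1/2) ≠ 0`)
    (m₀ : ℕ) (c : ℕ → ℂ)
    (hm₀ : Z (1 / 2 : ℂ) ≠ 0 → m₀ = 0)
    (hc : ∃ g : ℂ → ℂ, AnalyticAt ℂ g ((1 : ℂ) / 2) ∧
      ∀ᶠ s in 𝓝[≠] ((1 : ℂ) / 2),
        1 / (s * Z s) =
          (∑ k ∈ Finset.Icc 1 m₀, c k / (s - 1 / 2) ^ k) + g s) :
    (0 : EReal) < Filter.limsup
        (fun x : ℝ =>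
          (((mertensK K x -
              ∑ k ∈ Finset.Icc 1 m₀,
                (c k).re * Real.sqrt x * Real.log x ^ (k - 1) / (Nat.factorial (k - 1))) /
            (Real.sqrt x * Real.log x ^ (m - 1)) : ℝ) : EReal))
        Filter.atTop ∧
    Filter.liminf
        (fun x : ℝ =>
          (((mertensK K x -
              ∑ k ∈ Finset.Icc 1 m₀,
                (c k).re * Real.sqrt x * Real.log x ^ (k - 1) / (Nat.factorial (k - 1))) /
            (Real.sqrt x * Real.log x ^ (m - 1)) : ℝ) : EReal))
        Filter.atTop < (0 : EReal) := by
  obtain ⟨ε, hε, h⟩ := exists_pos_forall_not_eventually_le hZ hRH hγ hm hmult hc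
  have hden {u : ℝ} (hu : 0 < u) : Real.sqrt (Real.exp u) * Real.log (Real.exp u) ^ (m - 1) =
      u ^ (m - 1) * Real.exp (1 / 2 * u) ∧ 0 < u ^ (m - 1) * Real.exp (1 / 2 * u) := by
    refine ⟨?_, by positivity⟩
    rw [Real.log_exp, ← Real.exp_half, div_eq_inv_mul u 2, one_div, mul_comm]
  constructor
  · by_contra! hle
    refine h 1 abs_one ?_
    have hev := Real.tendsto_exp_atTop.eventually (eventually_lt_of_limsup_lt
      (hle.trans_lt (EReal.coe_pos.2 hε)))
    filter_upwards [hev, eventually_gt_atTop 0] with u hu hu0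
    obtain ⟨h1, h2⟩ := hden hu0
    rw [EReal.coe_lt_coe_iff, ← mertensRemainder_eq, h1, div_lt_iff₀ h2] at hu
    linarith
  · by_contra! hle
    refine h (-1) (by simp) ?_
    have hev := Real.tendsto_exp_atTop.eventually (eventually_lt_of_lt_liminf
      (lt_of_lt_of_le (EReal.coe_neg'.2 (neg_neg_of_pos hε)) hle))
    filter_upwards [hev, eventually_gt_atTop 0] with u hu hu0
    obtain ⟨h1, h2⟩ := hden hu0
    rw [EReal.coe_lt_coe_iff, ← mertensRemainder_eq, h1, lt_div_iff₀ h2] at hu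
    linarith
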